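/- Let p be any rational polyhedron in V. Then S(p)(ξ) = Σ_{f ∈ F(p)} μ(t(p,f))(ξ) · I(f)(ξ), where the sum is over all faces f of p, t(p,f) is the transverse cone of p along f, and μ(t(p,f)), a function on (V/lin(f))* = lin(f)^⊥ ⊂ V*, is regarded as a function on V* via Q-orthogonal projection. -/

import Mathlib

open MeasureTheory Filter Topology Set
open scoped RealInnerProductSpace Pointwise BigOperators

noncomputable section

/-- the ambient rational vector space: `ℝ^d` with the standard inner product, which is used
to identify `V` with its dual space `V^*`. -/
abbrev Vd (d : ℕ) := EuclideanSpace ℝ (Fin d)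

variable {d : ℕ}

/-- the duality pairing `⟨ξ, x⟩` between `V^*` and `V`, realized by the standard inner
product of `ℝ^d`. -/
def pairE {d : ℕ} (ξ x : Vd d) : ℝ := @inner ℝ _ _ ξ x

/-- `Λ` is a lattice of its span: it is generated by finitely many `ℝ`-independent vectors. -/
def IsLatticeSub (Λ : AddSubgroup (Vd d)) : Prop :=
  ∃ (k : ℕ) (v : Fin k → Vd d), LinearIndependent ℝ v ∧
    Λ = AddSubgroup.closure (Set.range v)

/-- `Λ` is a full-rank lattice in `ℝ^d`. -/
def IsFullLattice (Λ : AddSubgroup (Vd d)) : Prop :=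
  IsLatticeSub Λ ∧ Submodule.span ℝ (Λ : Set (Vd d)) = ⊤

/-- `x` is a rational point with respect to the lattice `Λ`. -/
def IsRatPoint (Λ : AddSubgroup (Vd d)) (x : Vd d) : Prop :=
  ∃ q : ℤ, q ≠ 0 ∧ (q : ℝ) • x ∈ Λ

/-- viewing `φ ∈ V` as a linear functional via the standard pairing, it takes integer values
on `Λ`, i.e. it belongs to the dual lattice. -/
def IsDualIntegral (Λ : AddSubgroup (Vd d)) (φ : Vd d) : Prop :=
  ∀ x ∈ Λ, ∃ n : ℤ, (pairE (φ) (x)) = (n : ℝ)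

/-- a rational polyhedron (inside the span of `Λ`): a finite intersection of half-spaces
bounded by rational affine hyperplanes. -/
def IsRatPolyhedron (Λ : AddSubgroup (Vd d)) (P : Set (Vd d)) : Prop :=
  ∃ (n : ℕ) (φ : Fin n → Vd d) (c : Fin n → ℚ),
    (∀ i, IsDualIntegral Λ (φ i)) ∧
    P = {x | x ∈ Submodule.span ℝ (Λ : Set (Vd d)) ∧ ∀ i, (pairE (φ i) x) ≤ (c i : ℝ)}

/-- the set `P` contains a straight (affine) line. -/
def ContainsLine (P : Set (Vd d)) : Prop :=
  ∃ x u : Vd d, u ≠ 0 ∧ ∀ t : ℝ, x + t • u ∈ P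

/-- equality of meromorphic-type functions near `0`: they agree near `0` outside a closed
set with empty interior (the polar set). -/
def MeroEqAt0 (f g : Vd d → ℝ) : Prop :=
  ∃ Z : Set (Vd d), IsClosed Z ∧ interior Z = ∅ ∧
    ∀ᶠ ξ in 𝓝 (0 : Vd d), ξ ∉ Z → f ξ = g ξ

/-- `g` is analytic at `0` and its Taylor coefficients are rational with respect to an
integral basis (i.e. the coefficients take rational values on dual-lattice vectors). -/
def HasRatSeriesAt0 (Λ : AddSubgroup (Vd d)) (g : Vd d → ℝ) : Prop :=
  ∃ p : FormalMultilinearSeries ℝ (Vd d) ℝ, HasFPowerSeriesAt g p 0 ∧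
    ∀ (n : ℕ) (w : Fin n → Vd d), (∀ i, IsDualIntegral Λ (w i)) →
      ∃ q : ℚ, (p n) w = (q : ℝ)

/-- `f` is meromorphic near `0` with rational Taylor coefficients: near `0` it is a quotient
of two analytic functions with rational Taylor coefficients. -/
def RatMeromorphicAt0 (Λ : AddSubgroup (Vd d)) (f : Vd d → ℝ) : Prop :=
  ∃ g h : Vd d → ℝ, HasRatSeriesAt0 Λ g ∧ HasRatSeriesAt0 Λ h ∧
    (¬ ∀ᶠ ξ in 𝓝 (0 : Vd d), h ξ = 0) ∧
    (∀ᶠ ξ in 𝓝 (0 : Vd d), h ξ ≠ 0 → f ξ * h ξ = g ξ)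

/-- `m` is the canonical Lebesgue measure carried by the rational affine subspace `A`,
normalized so that a fundamental parallelepiped of the lattice `Λ ∩ lin(A)` has volume `1`:
it is the image of the standard Lebesgue measure under a `ℤ`-basis parametrization. -/
def IsCanonicalMeasure (Λ : AddSubgroup (Vd d)) (A : Set (Vd d)) (m : Measure (Vd d)) : Prop :=
  ∃ (k : ℕ) (x₀ : Vd d) (v : Fin k → Vd d),
    x₀ ∈ A ∧ (∀ i, v i ∈ Λ) ∧ LinearIndependent ℝ v ∧
    A = {x | ∃ t : Fin k → ℝ, x = x₀ + ∑ i, t i • v i} ∧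
    (∀ y ∈ Λ, y ∈ Submodule.span ℝ (Set.range v) →
      ∃ c : Fin k → ℤ, y = ∑ i, (c i : ℝ) • v i) ∧
    m = Measure.map (fun t : Fin k → ℝ => x₀ + ∑ i, t i • v i) volume

/-- the characterizing properties of the map `I`: it sends rational polyhedra to meromorphic
functions with rational coefficients, vanishes on polyhedra containing lines, and is given by
`∫_P e^{⟨ξ,x⟩} dm_{<P>}(x)` wherever this integral converges. -/
def IsIMap (Λ : AddSubgroup (Vd d)) (I : Set (Vd d) → Vd d → ℝ) : Prop :=
  (∀ P, IsRatPolyhedron Λ P → RatMeromorphicAt0 Λ (I P)) ∧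
  (∀ P, IsRatPolyhedron Λ P → ContainsLine P → ∀ ξ, I P ξ = 0) ∧
  (∀ P, IsRatPolyhedron Λ P → ∀ m : Measure (Vd d),
    IsCanonicalMeasure Λ ((affineSpan ℝ P : AffineSubspace ℝ (Vd d)) : Set (Vd d)) m →
    ∀ ξ : Vd d, IntegrableOn (fun x => Real.exp (pairE (ξ) (x))) P m →
      I P ξ = ∫ x in P, Real.exp (pairE (ξ) (x)) ∂m)

/-- the characterizing properties of the map `S`: it sends rational polyhedra to meromorphic
functions with rational coefficients, vanishes on polyhedra containing lines, and is given by
`∑_{x ∈ P ∩ Λ} e^{⟨ξ,x⟩}` wherever this sum converges absolutely. -/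
def IsSMap (Λ : AddSubgroup (Vd d)) (S : Set (Vd d) → Vd d → ℝ) : Prop :=
  (∀ P, IsRatPolyhedron Λ P → RatMeromorphicAt0 Λ (S P)) ∧
  (∀ P, IsRatPolyhedron Λ P → ContainsLine P → ∀ ξ, S P ξ = 0) ∧
  (∀ P, IsRatPolyhedron Λ P → ∀ ξ : Vd d,
    Summable (fun x : ↥(P ∩ (Λ : Set (Vd d))) => Real.exp (pairE ξ (x : Vd d))) →
      S P ξ = ∑' x : ↥(P ∩ (Λ : Set (Vd d))), Real.exp (pairE ξ (x : Vd d)))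

/-- `F` is a (nonempty, exposed) face of the convex set `P`. -/
def IsFaceOf (P F : Set (Vd d)) : Prop :=
  F.Nonempty ∧ ∃ φ : Vd d, F = {x ∈ P | ∀ y ∈ P, (pairE (φ) (y)) ≤ (pairE (φ) (x))}

/-- `v` is a vertex of `P`. -/
def IsVertexOf (P : Set (Vd d)) (v : Vd d) : Prop := IsFaceOf P {v}

/-- the cone of feasible directions of `P` along the face `F` (computed at a point of the
relative interior of `F`). -/
def feasibleCone (P F : Set (Vd d)) : Set (Vd d) :=
  {u | ∃ x ∈ intrinsicInterior ℝ F, ∃ ε : ℝ, 0 < ε ∧ ∀ t : ℝ, 0 < t → t ≤ ε → x + t • u ∈ P}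

/-- the supporting cone `<F> + c(P,F)` of `P` along its face `F`. -/
def suppCone (P F : Set (Vd d)) : Set (Vd d) :=
  {z | ∃ a ∈ (affineSpan ℝ F : Set (Vd d)), ∃ u ∈ feasibleCone P F, z = a + u}

/-- the recession cone (cone of directions) of a convex set. -/
def recCone (P : Set (Vd d)) : Set (Vd d) :=
  {u | ∀ x ∈ P, ∀ t : ℝ, 0 ≤ t → x + t • u ∈ P}

/-- a rational affine cone with respect to the lattice `Λ`: a rational translate of a cone
generated by finitely many lattice vectors. -/
def IsRatAffineCone (Λ : AddSubgroup (Vd d)) (a : Set (Vd d)) : Prop :=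
  ∃ (s : Vd d) (n : ℕ) (v : Fin n → Vd d), IsRatPoint Λ s ∧ (∀ i, v i ∈ Λ) ∧
    a = {x | ∃ t : Fin n → ℝ, (∀ i, 0 ≤ t i) ∧ x = s + ∑ i, t i • v i}

/-- a rational (convex polyhedral) cone with vertex at the origin. -/
def IsRatCone (Λ : AddSubgroup (Vd d)) (c : Set (Vd d)) : Prop :=
  ∃ (n : ℕ) (v : Fin n → Vd d), (∀ i, v i ∈ Λ) ∧
    c = {x | ∃ t : Fin n → ℝ, (∀ i, 0 ≤ t i) ∧ x = ∑ i, t i • v i}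

/-- `Q` is a rational scalar product: a symmetric positive definite bilinear form taking
rational values on lattice vectors. -/
def IsRatInner (Λ : AddSubgroup (Vd d)) (Q : Vd d →ₗ[ℝ] Vd d →ₗ[ℝ] ℝ) : Prop :=
  (∀ x y, Q x y = Q y x) ∧ (∀ x : Vd d, x ≠ 0 → 0 < Q x x) ∧
  (∀ x ∈ Λ, ∀ y ∈ Λ, ∃ q : ℚ, Q x y = (q : ℝ))

/-- `π` realizes the quotient map `V → V/L` as the `Q`-orthogonal projection onto the
`Q`-orthogonal complement of `L`. -/
def IsQCoproj (Q : Vd d →ₗ[ℝ] Vd d →ₗ[ℝ] ℝ) (L : Submodule ℝ (Vd d))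
    (π : Vd d →ₗ[ℝ] Vd d) : Prop :=
  (∀ x, x - π x ∈ L) ∧ (∀ x : Vd d, ∀ y ∈ L, Q (π x) y = 0)

/-- `Λ'` is the lattice of a rational quotient space of `(V, Λ)`, realized inside `V` via the
`Q`-orthogonal projection along a rational subspace. -/
def IsQuotLattice (Q : Vd d →ₗ[ℝ] Vd d →ₗ[ℝ] ℝ) (Λ Λ' : AddSubgroup (Vd d)) : Prop :=
  ∃ (L : Submodule ℝ (Vd d)) (π : Vd d →ₗ[ℝ] Vd d),
    Submodule.span ℝ ((L : Set (Vd d)) ∩ (Λ : Set (Vd d))) = L ∧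
    IsQCoproj Q L π ∧ Λ' = AddSubgroup.map π.toAddMonoidHom Λ

/-- a family of maps `I` indexed by the rational quotient spaces of `(V,Λ)`, each member
satisfying the characterizing properties of the integral generating function. -/
def IsIFamily (Q : Vd d →ₗ[ℝ] Vd d →ₗ[ℝ] ℝ) (Λ : AddSubgroup (Vd d))
    (I : AddSubgroup (Vd d) → Set (Vd d) → Vd d → ℝ) : Prop :=
  ∀ Λ', IsQuotLattice Q Λ Λ' → IsIMap Λ' (I Λ')

/-- a family of maps `S` indexed by the rational quotient spaces of `(V,Λ)`, each member
satisfying the characterizing properties of the lattice-point generating function. -/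
def IsSFamily (Q : Vd d →ₗ[ℝ] Vd d →ₗ[ℝ] ℝ) (Λ : AddSubgroup (Vd d))
    (S : AddSubgroup (Vd d) → Set (Vd d) → Vd d → ℝ) : Prop :=
  ∀ Λ', IsQuotLattice Q Λ Λ' → IsSMap Λ' (S Λ')

/-- the defining properties (a),(b),(c) of the family `μ` of Berline--Vergne:
each `μ(a)` is meromorphic with rational coefficients near `0`, `μ_{0}({0}) = 1`, and for
every pointed rational affine cone `a` in a rational quotient `W` of `V` one has
`S(a) = ∑_{f ∈ F(a)} μ(t(a,f)) I(f)`, where the transverse cone `t(a,f)` is realized inside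
`V` by the `Q`-orthogonal projection `π F` along `lin(f)`, and functions on quotient duals
are extended by `Q`-orthogonal projection. -/
def IsMuCore (Λ : AddSubgroup (Vd d)) (Q : Vd d →ₗ[ℝ] Vd d →ₗ[ℝ] ℝ)
    (I S μ : AddSubgroup (Vd d) → Set (Vd d) → Vd d → ℝ) : Prop :=
  (∀ Λ', IsQuotLattice Q Λ Λ' → ∀ a, IsRatAffineCone Λ' a → ¬ ContainsLine a →
      RatMeromorphicAt0 Λ' (μ Λ' a)) ∧
  (∀ ξ, μ ⊥ ({0} : Set (Vd d)) ξ = 1) ∧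
  (∀ Λ', IsQuotLattice Q Λ Λ' → ∀ a, IsRatAffineCone Λ' a → ¬ ContainsLine a →
    ∀ π : Set (Vd d) → (Vd d →ₗ[ℝ] Vd d),
      (∀ F, IsFaceOf a F → IsQCoproj Q (affineSpan ℝ F).direction (π F)) →
      MeroEqAt0 (S Λ' a)
        (fun ξ => ∑ᶠ F ∈ {F | IsFaceOf a F},
          μ (AddSubgroup.map (π F).toAddMonoidHom Λ') ((π F) '' suppCone a F) ξ
            * I Λ' F ξ))

/-- the family `μ`, extended by `μ(a) = 0` on cones containing a straight line. -/
def IsMuFamily (Λ : AddSubgroup (Vd d)) (Q : Vd d →ₗ[ℝ] Vd d →ₗ[ℝ] ℝ)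
    (I S μ : AddSubgroup (Vd d) → Set (Vd d) → Vd d → ℝ) : Prop :=
  IsMuCore Λ Q I S μ ∧
  (∀ Λ', IsQuotLattice Q Λ Λ' → ∀ a, IsRatAffineCone Λ' a → ContainsLine a →
    ∀ ξ, μ Λ' a ξ = 0)

/-- the trace pairing of two `n`-multilinear forms on `ℝ^d`, computed in the standard basis. -/
def multiPair {n : ℕ} (p q : ContinuousMultilinearMap ℝ (fun _ : Fin n => Vd d) ℝ) : ℝ :=
  ∑ ι : Fin n → Fin d,
    p (fun j => (EuclideanSpace.basisFun (Fin d) ℝ) (ι j)) *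
    q (fun j => (EuclideanSpace.basisFun (Fin d) ℝ) (ι j))

/-- the action on `h` of the infinite-order constant-coefficient differential operator whose
symbol has Taylor series `p` at `0`; on polynomials `h` the sum is finite.  Its defining
property is `D(Φ)e^{⟨ξ,·⟩} = Φ(ξ)e^{⟨ξ,·⟩}`. -/
def DOp (p : FormalMultilinearSeries ℝ (Vd d) ℝ) (h : Vd d → ℝ) (x : Vd d) : ℝ :=
  ∑ᶠ n : ℕ, multiPair (p n) (iteratedFDeriv ℝ n h x)

/-- `h` is a polynomial function on `ℝ^d`. -/
def IsPolyFun (h : Vd d → ℝ) : Prop :=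
  ∃ p : MvPolynomial (Fin d) ℝ, ∀ x : Vd d, h x = MvPolynomial.eval (fun i => x i) p

/-- `h` is a polynomial function of degree at most `r` on `ℝ^d`. -/
def IsPolyFunOfDeg (h : Vd d → ℝ) (r : ℕ) : Prop :=
  ∃ p : MvPolynomial (Fin d) ℝ, p.totalDegree ≤ r ∧
    ∀ x : Vd d, h x = MvPolynomial.eval (fun i => x i) p

end


section Germs
variable {d : ℕ}

/-- the filter of sets that contain a neighbourhood of `0` outside a closed nowhere dense set. -/
def meroFilter (d : ℕ) : Filter (Vd d) where
  sets := {s | ∃ Z : Set (Vd d), IsClosed Z ∧ interior Z = ∅ ∧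
    ∀ᶠ ξ in 𝓝 (0 : Vd d), ξ ∉ Z → ξ ∈ s}
  univ_sets := ⟨∅, isClosed_empty, interior_empty, by simp⟩
  sets_of_superset := by
    rintro s t ⟨Z, h1, h2, h3⟩ hst
    exact ⟨Z, h1, h2, h3.mono fun ξ h h' => hst (h h')⟩
  inter_sets := by
    rintro s t ⟨Z, h1, h2, h3⟩ ⟨Z', h1', h2', h3'⟩
    refine ⟨Z ∪ Z', h1.union h1', ?_, ?_⟩
    · rw [interior_union_isClosed_of_interior_empty h1 h2', h2]
    · filter_upwards [h3, h3'] with ξ a b c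
      rw [Set.mem_union, not_or] at c
      exact ⟨a c.1, b c.2⟩

theorem meroEq_iff (f g : Vd d → ℝ) : MeroEqAt0 f g ↔ f =ᶠ[meroFilter d] g := Iff.rfl

theorem meroFilter_le : meroFilter d ≤ 𝓝 0 := by
  intro s hs
  exact ⟨∅, isClosed_empty, interior_empty, by filter_upwards [hs] with ξ h _ using h⟩

instance meroFilter_neBot : NeBot (meroFilter d) := by
  refine ⟨fun h => ?_⟩
  have : (∅ : Set (Vd d)) ∈ meroFilter d := by rw [h]; trivial
  obtain ⟨Z, h1, h2, h3⟩ := this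
  have : (0 : Vd d) ∈ interior Z := by
    rw [mem_interior_iff_mem_nhds]
    filter_upwards [h3] with ξ hξ
    by_contra h
    exact hξ h
  rw [h2] at this
  exact this

theorem eventually_ne_of_analytic {h : Vd d → ℝ} (ha : AnalyticAt ℝ h 0)
    (hne : ¬ ∀ᶠ ξ in 𝓝 (0 : Vd d), h ξ = 0) : ∀ᶠ ξ in meroFilter d, h ξ ≠ 0 := by
  obtain ⟨r, hr, hball⟩ := Metric.eventually_nhds_iff_ball.1 ha.eventually_analyticAt
  have hA : AnalyticOnNhd ℝ h (Metric.ball 0 r) := fun x hx => hball x hx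
  have hsub : Metric.closedBall (0 : Vd d) (r/2) ⊆ Metric.ball 0 r :=
    Metric.closedBall_subset_ball (by linarith)
  refine ⟨Metric.closedBall 0 (r/2) ∩ h ⁻¹' {0}, ?_, ?_, ?_⟩
  · exact (hA.continuousOn.mono hsub).preimage_isClosed_of_isClosed Metric.isClosed_closedBall
      isClosed_singleton
  · rw [Set.eq_empty_iff_forall_notMem]
    intro z hz
    have hz' := mem_interior_iff_mem_nhds.1 hz
    have hzm := interior_subset hz
    apply hne
    have := hA.eqOn_zero_of_preconnected_of_eventuallyEq_zero
      (convex_ball 0 r).isPreconnected (hsub hzm.1)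
      (by filter_upwards [hz'] with x hx using hx.2)
    filter_upwards [Metric.ball_mem_nhds (0 : Vd d) hr] with x hx using this hx
  · filter_upwards [Metric.closedBall_mem_nhds (0 : Vd d) (half_pos hr)] with ξ h1 h2 h3
    exact h2 ⟨h1, h3⟩

/-- `f` is a quotient of analytic functions near `0`. -/
def Mer (f : Vd d → ℝ) : Prop :=
  ∃ g h : Vd d → ℝ, AnalyticAt ℝ g 0 ∧ AnalyticAt ℝ h 0 ∧
    (¬ ∀ᶠ ξ in 𝓝 (0 : Vd d), h ξ = 0) ∧
    (∀ᶠ ξ in 𝓝 (0 : Vd d), h ξ ≠ 0 → f ξ * h ξ = g ξ)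

theorem RatMeromorphicAt0.mer {Λ : AddSubgroup (Vd d)} {f : Vd d → ℝ}
    (hf : RatMeromorphicAt0 Λ f) : Mer f := by
  obtain ⟨g, h, ⟨p, hp, _⟩, ⟨q, hq, _⟩, h1, h2⟩ := hf
  exact ⟨g, h, hp.analyticAt, hq.analyticAt, h1, h2⟩

theorem Mer.of_analytic {f : Vd d → ℝ} (hf : AnalyticAt ℝ f 0) : Mer f := by
  refine ⟨f, fun _ => 1, hf, analyticAt_const, ?_, ?_⟩
  · intro h
    obtain ⟨x, hx⟩ := h.exists
    exact one_ne_zero hx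
  · simp

theorem not_germ_mul {h h' : Vd d → ℝ} (ha : AnalyticAt ℝ h 0)
    (hne : ¬ ∀ᶠ ξ in 𝓝 (0 : Vd d), h ξ = 0) (ha' : AnalyticAt ℝ h' 0)
    (hne' : ¬ ∀ᶠ ξ in 𝓝 (0 : Vd d), h' ξ = 0) :
    ¬ ∀ᶠ ξ in 𝓝 (0 : Vd d), h ξ * h' ξ = 0 := by
  intro hh
  have := ((eventually_ne_of_analytic ha hne).and (eventually_ne_of_analytic ha' hne')).and
    (meroFilter_le hh)
  obtain ⟨ξ, ⟨h1, h2⟩, h3⟩ := this.exists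
  have h3 : h ξ * h' ξ = 0 := h3
  exact (mul_ne_zero h1 h2) h3

theorem Mer.add {f f' : Vd d → ℝ} (hf : Mer f) (hf' : Mer f') : Mer (fun ξ => f ξ + f' ξ) := by
  obtain ⟨g, h, hg, hh, h0, he⟩ := hf
  obtain ⟨g', h', hg', hh', h0', he'⟩ := hf'
  refine ⟨fun ξ => g ξ * h' ξ + g' ξ * h ξ, fun ξ => h ξ * h' ξ, ?_, ?_,
    not_germ_mul hh h0 hh' h0', ?_⟩
  · exact (hg.mul hh').add (hg'.mul hh)
  · exact hh.mul hh'
  · filter_upwards [he, he'] with ξ a b c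
    have a := a (left_ne_zero_of_mul c)
    have b := b (right_ne_zero_of_mul c)
    rw [← a, ← b]; ring

theorem Mer.analytic_mul {f e : Vd d → ℝ} (hf : Mer f) (he : AnalyticAt ℝ e 0) :
    Mer (fun ξ => e ξ * f ξ) := by
  obtain ⟨g, h, hg, hh, h0, hE⟩ := hf
  refine ⟨fun ξ => e ξ * g ξ, h, he.mul hg, hh, h0, ?_⟩
  filter_upwards [hE] with ξ a b
  rw [← a b]; ring

theorem Mer.const_mul {f : Vd d → ℝ} (hf : Mer f) (c : ℝ) : Mer (fun ξ => c * f ξ) :=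
  hf.analytic_mul analyticAt_const

theorem Mer.sum {ι : Type*} (s : Finset ι) {f : ι → Vd d → ℝ} (hf : ∀ i ∈ s, Mer (f i)) :
    Mer (fun ξ => ∑ i ∈ s, f i ξ) := by
  classical
  induction s using Finset.induction_on with
  | empty => simpa using Mer.of_analytic (d := d) (analyticAt_const (v := (0 : ℝ)))
  | insert a s ha ih =>
    simp only [Finset.sum_insert ha]
    exact (hf a (by simp)).add (ih fun i hi => hf i (by simp [hi]))

theorem Mer.eq_zero {f : Vd d → ℝ} (hf : Mer f) {Ω : Set (Vd d)} (hΩ : IsOpen Ω)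
    (h0 : (0 : Vd d) ∈ closure Ω) (hz : ∀ ξ ∈ Ω, f ξ = 0) : f =ᶠ[meroFilter d] 0 := by
  obtain ⟨g, h, hg, hh, hne, hE⟩ := hf
  obtain ⟨r, hr, hball⟩ := Metric.eventually_nhds_iff_ball.1
    ((hg.mul hh).eventually_analyticAt.and hE)
  have hA : AnalyticOnNhd ℝ (fun ξ => g ξ * h ξ) (Metric.ball 0 r) := fun x hx => (hball x hx).1
  obtain ⟨z, hzb, hzΩ⟩ := mem_closure_iff.1 h0 _ Metric.isOpen_ball (Metric.mem_ball_self hr)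
  have key := hA.eqOn_zero_of_preconnected_of_eventuallyEq_zero
      (convex_ball 0 r).isPreconnected hzb (by
        filter_upwards [hΩ.mem_nhds hzΩ, Metric.isOpen_ball.mem_nhds hzb] with x hx hxb
        by_cases hx0 : h x = 0
        · simp [hx0]
        · have := (hball x hxb).2 hx0
          simp [← this, hz x hx])
  filter_upwards [eventually_ne_of_analytic hh hne,
    meroFilter_le (Metric.ball_mem_nhds (0 : Vd d) hr)] with x hx hxb
  have h1 := key hxb
  have h2 := (hball x hxb).2 hx
  simp only [Pi.zero_apply, mul_eq_zero] at h1
  rcases h1 with h1 | h1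
  · rw [h1] at h2
    simpa [hx] using h2
  · exact absurd h1 hx

/-- germ of a function along `meroFilter`. -/
abbrev MGerm (d : ℕ) := Germ (meroFilter d) ℝ

/-- the class of a function. -/
def toG (f : Vd d → ℝ) : MGerm d := (f : Germ (meroFilter d) ℝ)

theorem toG_eq {f g : Vd d → ℝ} : toG f = toG g ↔ f =ᶠ[meroFilter d] g := Germ.coe_eq

theorem toG_sum {ι : Type*} (s : Finset ι) (f : ι → Vd d → ℝ) :
    toG (fun ξ => ∑ i ∈ s, f i ξ) = ∑ i ∈ s, toG (f i) := by
  have := map_sum (Germ.coeRingHom (R := ℝ) (meroFilter d)) f s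
  have h2 : (fun ξ => ∑ i ∈ s, f i ξ) = ∑ i ∈ s, f i := by
    ext ξ
    simp
  rw [h2]
  exact this

theorem toG_mul (f g : Vd d → ℝ) : toG (fun ξ => f ξ * g ξ) = toG f * toG g := rfl

theorem toG_smul (c : ℝ) (g : Vd d → ℝ) : toG (fun ξ => c * g ξ) = c • toG g := rfl

theorem toG_zero : toG (fun _ => 0 : Vd d → ℝ) = 0 := rfl

/-- extension of a family to a linear map, when linear relations are preserved. -/
theorem exists_linear_of_relations {ι M N : Type*} [AddCommGroup M] [Module ℝ M]
    [AddCommGroup N] [Module ℝ N] (v : ι → M) (w : ι → N)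
    (h : ∀ (s : Finset ι) (c : ι → ℝ), ∑ i ∈ s, c i • v i = 0 → ∑ i ∈ s, c i • w i = 0) :
    ∃ Φ : M →ₗ[ℝ] N, ∀ i, Φ (v i) = w i := by
  set a := Finsupp.linearCombination ℝ v
  set b := Finsupp.linearCombination ℝ w
  have hker : LinearMap.ker a ≤ LinearMap.ker b := by
    intro x hx
    rw [LinearMap.mem_ker] at hx ⊢
    simp only [a, b, Finsupp.linearCombination_apply, Finsupp.sum] at hx ⊢
    exact h _ _ hx
  obtain ⟨Φ, hΦ⟩ := LinearMap.exists_extend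
    ((LinearMap.ker a).liftQ b hker ∘ₗ a.quotKerEquivRange.symm.toLinearMap)
  refine ⟨Φ, fun i => ?_⟩
  have h1 : v i = a (Finsupp.single i 1) := by simp [a]
  have h2 : a (Finsupp.single i 1) ∈ LinearMap.range a := ⟨_, rfl⟩
  have h3 := LinearMap.congr_fun hΦ ⟨_, h2⟩
  simp only [LinearMap.comp_apply, Submodule.subtype_apply, LinearEquiv.coe_coe] at h3
  have h4 : a.quotKerEquivRange.symm ⟨_, h2⟩ = Submodule.Quotient.mk (Finsupp.single i 1) := by
    rw [LinearEquiv.symm_apply_eq]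
    ext; rfl
  rw [h1, h3, h4]
  simp [b]

end Germs

section Poly
variable {d : ℕ}

theorem pairE_add (φ x y : Vd d) : pairE φ (x + y) = pairE φ x + pairE φ y := inner_add_right _ _ _
theorem pairE_sub (φ x y : Vd d) : pairE φ (x - y) = pairE φ x - pairE φ y := inner_sub_right _ _ _
theorem pairE_smul (φ : Vd d) (t : ℝ) (x : Vd d) : pairE φ (t • x) = t * pairE φ x :=
  real_inner_smul_right _ _ _
theorem pairE_neg_left (φ x : Vd d) : pairE (-φ) x = - pairE φ x := inner_neg_left _ _
theorem pairE_zero (φ : Vd d) : pairE φ 0 = 0 := inner_zero_right _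
theorem pairE_comm (φ x : Vd d) : pairE φ x = pairE x φ := real_inner_comm _ _
theorem pairE_sum {ι : Type*} (s : Finset ι) (φ : Vd d) (f : ι → Vd d) :
    pairE φ (∑ i ∈ s, f i) = ∑ i ∈ s, pairE φ (f i) := inner_sum _ _ _
theorem pairE_continuous (φ : Vd d) : Continuous (fun x => pairE φ x) :=
  continuous_const.inner continuous_id

/-- the pairing as a linear map in the second variable. -/
noncomputable def pairL (φ : Vd d) : Vd d →ₗ[ℝ] ℝ where
  toFun x := pairE φ x
  map_add' := pairE_add φ
  map_smul' := pairE_smul φ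

theorem pairL_apply (φ x : Vd d) : pairL φ x = pairE φ x := rfl

/-- polyhedron of a system of inequalities. -/
def hpoly {ι : Type*} (φ : ι → Vd d) (c : ι → ℚ) : Set (Vd d) :=
  {x | ∀ i, pairE (φ i) x ≤ (c i : ℝ)}

theorem ratPoly_of {Λ : AddSubgroup (Vd d)} (hΛ : IsFullLattice Λ) {ι : Type*} [Finite ι]
    (φ : ι → Vd d) (c : ι → ℚ) (h : ∀ i, IsDualIntegral Λ (φ i)) :
    IsRatPolyhedron Λ (hpoly φ c) := by
  obtain ⟨n, ⟨e⟩⟩ := Finite.exists_equiv_fin ι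
  refine ⟨n, φ ∘ e.symm, c ∘ e.symm, fun i => h _, ?_⟩
  ext x
  simp only [hpoly, Set.mem_ofPred_eq, hΛ.2, Submodule.mem_top, true_and, Function.comp]
  exact ⟨fun h i => h _, fun h i => by simpa using h (e i)⟩

theorem ratPoly_exists {Λ : AddSubgroup (Vd d)} (hΛ : IsFullLattice Λ) {P : Set (Vd d)}
    (hP : IsRatPolyhedron Λ P) : ∃ (n : ℕ) (φ : Fin n → Vd d) (c : Fin n → ℚ),
      (∀ i, IsDualIntegral Λ (φ i)) ∧ P = hpoly φ c := by
  obtain ⟨n, φ, c, h, rfl⟩ := hP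
  refine ⟨n, φ, c, h, ?_⟩
  ext x
  simp [hpoly, hΛ.2]

theorem ratPoly_inter {Λ : AddSubgroup (Vd d)} (hΛ : IsFullLattice Λ) {P P' : Set (Vd d)}
    (hP : IsRatPolyhedron Λ P) (hP' : IsRatPolyhedron Λ P') : IsRatPolyhedron Λ (P ∩ P') := by
  obtain ⟨n, φ, c, h, rfl⟩ := ratPoly_exists hΛ hP
  obtain ⟨n', φ', c', h', rfl⟩ := ratPoly_exists hΛ hP'
  have := ratPoly_of hΛ (Sum.elim φ φ') (Sum.elim c c') (by rintro (i | i); exacts [h i, h' i])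
  convert this using 1
  ext x
  simp [hpoly]

theorem ratPoly_univ {Λ : AddSubgroup (Vd d)} (hΛ : IsFullLattice Λ) :
    IsRatPolyhedron Λ (Set.univ : Set (Vd d)) := by
  have := ratPoly_of hΛ (Empty.elim : Empty → Vd d) Empty.elim (by rintro ⟨⟩)
  convert this using 1
  ext x
  simp [hpoly]

theorem hpoly_closed {ι : Type*} (φ : ι → Vd d) (c : ι → ℚ) : IsClosed (hpoly φ c) := by
  have : hpoly φ c = ⋂ i, {x | pairE (φ i) x ≤ (c i : ℝ)} := by ext; simp [hpoly]
  rw [this]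
  exact isClosed_iInter fun i => isClosed_le (pairE_continuous _) continuous_const

theorem hpoly_convex {ι : Type*} (φ : ι → Vd d) (c : ι → ℚ) : Convex ℝ (hpoly φ c) := by
  intro x hx y hy a b ha hb hab i
  rw [pairE_add, pairE_smul, pairE_smul]
  have h1 := mul_le_mul_of_nonneg_left (hx i) ha
  have h2 := mul_le_mul_of_nonneg_left (hy i) hb
  calc _ ≤ a * (c i : ℝ) + b * c i := add_le_add h1 h2
    _ = c i := by rw [← add_mul, hab, one_mul]

theorem ratPoly_closed {Λ : AddSubgroup (Vd d)} (hΛ : IsFullLattice Λ) {P : Set (Vd d)}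
    (hP : IsRatPolyhedron Λ P) : IsClosed P := by
  obtain ⟨n, φ, c, h, rfl⟩ := ratPoly_exists hΛ hP
  exact hpoly_closed _ _

theorem ratPoly_convex {Λ : AddSubgroup (Vd d)} (hΛ : IsFullLattice Λ) {P : Set (Vd d)}
    (hP : IsRatPolyhedron Λ P) : Convex ℝ P := by
  obtain ⟨n, φ, c, h, rfl⟩ := ratPoly_exists hΛ hP
  exact hpoly_convex _ _

theorem IsDualIntegral.neg {Λ : AddSubgroup (Vd d)} {φ : Vd d} (h : IsDualIntegral Λ φ) :
    IsDualIntegral Λ (-φ) := by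
  intro x hx
  obtain ⟨n, hn⟩ := h x hx
  exact ⟨-n, by rw [pairE_neg_left, hn]; simp⟩

theorem ratPoly_translate {Λ : AddSubgroup (Vd d)} (hΛ : IsFullLattice Λ) {P : Set (Vd d)}
    (hP : IsRatPolyhedron Λ P) {u : Vd d} (hu : u ∈ Λ) :
    IsRatPolyhedron Λ ((fun x => x + u) '' P) := by
  obtain ⟨n, φ, c, h, rfl⟩ := ratPoly_exists hΛ hP
  choose m hm using fun i => h i u hu
  have := ratPoly_of hΛ φ (fun i => c i + m i) h
  convert this using 1
  ext x
  simp only [Set.image_add_right, Set.mem_preimage, hpoly, Set.mem_ofPred_eq]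
  refine forall_congr' fun i => ?_
  rw [← sub_eq_add_neg, pairE_sub, hm]
  push_cast
  exact sub_le_iff_le_add

/-- tangent (supporting) cone of `P` at `w`, empty if `w ∉ P`. -/
def tanC (P : Set (Vd d)) (w : Vd d) : Set (Vd d) :=
  {z | w ∈ P ∧ ∃ ε : ℝ, 0 < ε ∧ ∀ t : ℝ, 0 < t → t ≤ ε → w + t • (z - w) ∈ P}

theorem tanC_hpoly {ι : Type*} [Finite ι] (φ : ι → Vd d) (c : ι → ℚ) {w : Vd d}
    (hw : w ∈ hpoly φ c) :
    tanC (hpoly φ c) w = {x | ∀ i, pairE (φ i) w = c i → pairE (φ i) x ≤ (c i : ℝ)} := by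
  ext z
  constructor
  · rintro ⟨_, ε, hε, h⟩ i hi
    have := h ε hε le_rfl i
    rw [pairE_add, pairE_smul, pairE_sub, hi] at this
    nlinarith
  · intro hz
    refine ⟨hw, ?_⟩
    have key : ∀ᶠ t in 𝓝[>] (0 : ℝ), ∀ i, pairE (φ i) (w + t • (z - w)) ≤ (c i : ℝ) := by
      rw [Filter.eventually_all]
      intro i
      rcases eq_or_lt_of_le (hw i) with h | h
      · filter_upwards [self_mem_nhdsWithin] with t ht
        rw [pairE_add, pairE_smul, pairE_sub, h]
        have := hz i h
        have ht : 0 < t := ht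
        nlinarith
      · have hc : Continuous (fun t : ℝ => pairE (φ i) (w + t • (z - w))) :=
          (pairE_continuous _).comp (by fun_prop)
        have : ∀ᶠ t in 𝓝 (0 : ℝ), pairE (φ i) (w + t • (z - w)) < (c i : ℝ) := by
          apply hc.continuousAt.eventually_lt_const
          simpa using h
        exact (this.filter_mono nhdsWithin_le_nhds).mono fun t ht => ht.le
    rw [eventually_nhdsWithin_iff, Metric.eventually_nhds_iff] at key
    obtain ⟨ε, hε, h⟩ := key
    refine ⟨ε / 2, half_pos hε, fun t ht ht' => h ?_ ht⟩
    rw [Real.dist_eq, sub_zero, abs_of_pos ht]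
    linarith

theorem ratPoly_tanC {Λ : AddSubgroup (Vd d)} (hΛ : IsFullLattice Λ) {P : Set (Vd d)}
    (hP : IsRatPolyhedron Λ P) (w : Vd d) : IsRatPolyhedron Λ (tanC P w) := by
  obtain ⟨n, φ, c, h, rfl⟩ := ratPoly_exists hΛ hP
  by_cases hw : w ∈ hpoly φ c
  · rw [tanC_hpoly _ _ hw]
    have := ratPoly_of hΛ (fun i : {i // pairE (φ i) w = c i} => φ i) (fun i => c i)
      (fun i => h i)
    convert this using 1
    ext x
    simp [hpoly]
  · have h0 : tanC (hpoly φ c) w = hpoly (fun _ : Unit => (0 : Vd d)) (fun _ => -1) := by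
      ext x
      refine iff_of_false (fun hx => hw hx.1) (fun hx => ?_)
      have := hx ()
      rw [pairE_comm, pairE_zero] at this
      norm_num at this
    rw [h0]
    exact ratPoly_of hΛ _ _ (fun _ x _ => ⟨0, by simp [pairE]⟩)

theorem tanC_local {Λ : AddSubgroup (Vd d)} (hΛ : IsFullLattice Λ) {P : Set (Vd d)}
    (hP : IsRatPolyhedron Λ P) {w : Vd d} (hw : w ∈ P) :
    ∀ᶠ z in 𝓝 w, z ∈ tanC P w → z ∈ P := by
  obtain ⟨n, φ, c, h, rfl⟩ := ratPoly_exists hΛ hP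
  rw [tanC_hpoly _ _ hw]
  have key : ∀ᶠ z in 𝓝 w, ∀ i, pairE (φ i) w ≠ c i → pairE (φ i) z ≤ (c i : ℝ) := by
    rw [Filter.eventually_all]
    intro i
    rcases eq_or_lt_of_le (hw i) with h | h
    · exact Filter.Eventually.of_forall fun z hz => absurd h hz
    · have : ∀ᶠ z in 𝓝 w, pairE (φ i) z < (c i : ℝ) :=
        (pairE_continuous (φ i)).continuousAt.eventually_lt_const h
      exact this.mono fun z hz _ => hz.le
  filter_upwards [key] with z hz hz' i
  by_cases hi : pairE (φ i) w = c i
  exacts [hz' i hi, hz i hi]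

theorem subset_tanC {P : Set (Vd d)} (hP : Convex ℝ P) {w : Vd d} (hw : w ∈ P) :
    P ⊆ tanC P w := by
  intro z hz
  refine ⟨hw, 1, one_pos, fun t ht ht' => ?_⟩
  exact hP.add_smul_sub_mem hw hz ⟨ht.le, ht'⟩

theorem tanC_smul {P : Set (Vd d)} {w z : Vd d} (hz : z ∈ tanC P w) {s : ℝ} (hs : 0 ≤ s) :
    w + s • (z - w) ∈ tanC P w := by
  obtain ⟨hw, ε, hε, h⟩ := hz
  rcases hs.eq_or_lt with rfl | hs
  · exact ⟨hw, 1, one_pos, fun t _ _ => by simpa using hw⟩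
  · refine ⟨hw, ε / s, by positivity, fun t ht ht' => ?_⟩
    have := h (t * s) (by positivity) ((le_div_iff₀ hs).1 ht')
    rw [add_sub_cancel_left, smul_smul]
    exact this

theorem tanC_mono {P P' : Set (Vd d)} (h : P ⊆ P') (w : Vd d) : tanC P w ⊆ tanC P' w := by
  rintro z ⟨hw, ε, hε, h'⟩
  exact ⟨h hw, ε, hε, fun t a b => h (h' t a b)⟩

theorem tanC_empty {P : Set (Vd d)} {w : Vd d} (hw : w ∉ P) : tanC P w = ∅ := by
  ext z; simp [tanC, hw]

theorem self_mem_tanC {P : Set (Vd d)} {w : Vd d} (hw : w ∈ P) : w ∈ tanC P w :=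
  ⟨hw, 1, one_pos, fun t _ _ => by simpa using hw⟩

/-- if two opposite small steps stay in `P`, the tangent cone contains a line. -/
theorem tanC_line {P : Set (Vd d)} (hP : Convex ℝ P) {w u : Vd d} (hu : u ≠ 0)
    (h1 : w + u ∈ P) (h2 : w - u ∈ P) : ContainsLine (tanC P w) := by
  have hw : w ∈ P := by
    have := hP h1 h2 (a := 1/2) (b := 1/2) (by norm_num) (by norm_num) (by norm_num)
    convert this using 1
    module
  refine ⟨w, u, hu, fun t => ?_⟩
  rcases le_total 0 t with ht | ht
  · have := tanC_smul (subset_tanC hP hw h1) ht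
    simpa using this
  · have := tanC_smul (subset_tanC hP hw h2) (neg_nonneg.2 ht)
    convert this using 1
    module

/-- direction of a line inside a polyhedron. -/
theorem hpoly_line_iff {ι : Type*} (φ : ι → Vd d) (c : ι → ℚ) {x u : Vd d}
    (h : ∀ t : ℝ, x + t • u ∈ hpoly φ c) (i : ι) : pairE (φ i) u = 0 := by
  by_contra h0
  have := h ((c i - pairE (φ i) x + 1) / pairE (φ i) u) i
  rw [pairE_add, pairE_smul, div_mul_cancel₀ _ h0] at this
  linarith

theorem tanC_eventually {Λ : AddSubgroup (Vd d)} (hΛ : IsFullLattice Λ) {P : Set (Vd d)}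
    (hP : IsRatPolyhedron Λ P) (w z : Vd d) :
    ∀ᶠ t in 𝓝[>] (0 : ℝ), (w + t • (z - w) ∈ P ↔ z ∈ tanC P w) := by
  by_cases hw : w ∈ P
  · by_cases hz : z ∈ tanC P w
    · obtain ⟨_, ε, hε, h⟩ := id hz
      have : Ioc (0:ℝ) ε ∈ 𝓝[>] (0 : ℝ) := Ioc_mem_nhdsGT hε
      filter_upwards [this] with t ht
      exact iff_of_true (h t ht.1 ht.2) hz
    · filter_upwards [self_mem_nhdsWithin] with t ht
      have ht : 0 < t := ht
      refine iff_of_false (fun h => hz ?_) hz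
      have := tanC_smul (subset_tanC (ratPoly_convex hΛ hP) hw h) (inv_nonneg.2 ht.le)
      rw [add_sub_cancel_left, smul_smul, inv_mul_cancel₀ ht.ne', one_smul] at this
      simpa using this
  · have hc : Continuous (fun t : ℝ => w + t • (z - w)) := by fun_prop
    have : ∀ᶠ t in 𝓝 (0 : ℝ), w + t • (z - w) ∈ Pᶜ := by
      apply hc.continuousAt.eventually_mem
      apply (ratPoly_closed hΛ hP).isOpen_compl.mem_nhds
      simpa using hw
    filter_upwards [this.filter_mono nhdsWithin_le_nhds] with t ht
    rw [tanC_empty hw]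
    simpa using ht

end Poly

section Rational
variable {d : ℕ}

theorem lattice_basis {Λ : AddSubgroup (Vd d)} (hΛ : IsFullLattice Λ) :
    ∃ (k : ℕ) (b : Module.Basis (Fin k) ℝ (Vd d)), (∀ i, b i ∈ Λ) ∧
      ∀ x ∈ Λ, ∀ i, ∃ n : ℤ, b.repr x i = n := by
  obtain ⟨⟨k, v, hv, rfl⟩, hs⟩ := hΛ
  have hspan : ⊤ ≤ Submodule.span ℝ (Set.range v) := by
    rw [← hs, Submodule.span_le]
    have : AddSubgroup.closure (Set.range v) ≤ (Submodule.span ℝ (Set.range v)).toAddSubgroup := by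
      rw [AddSubgroup.closure_le]
      exact Submodule.subset_span
    exact this
  set b := Module.Basis.mk hv hspan with hbdef
  have hb : ∀ j, b j = v j := fun j => by rw [hbdef, Module.Basis.mk_apply]
  clear_value b
  refine ⟨k, b, fun i => ?_, fun x hx i => ?_⟩
  · rw [hb]
    exact AddSubgroup.subset_closure ⟨i, rfl⟩
  · induction hx using AddSubgroup.closure_induction with
    | mem x hx =>
      obtain ⟨j, rfl⟩ := hx
      rw [← hb, Module.Basis.repr_self, Finsupp.single_apply]
      split_ifs
      exacts [⟨1, by simp⟩, ⟨0, by simp⟩]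
    | zero => exact ⟨0, by simp⟩
    | add x y _ _ h1 h2 =>
      obtain ⟨n, hn⟩ := h1
      obtain ⟨m, hm⟩ := h2
      exact ⟨n + m, by simp [hn, hm]⟩
    | neg x _ h1 =>
      obtain ⟨n, hn⟩ := h1
      exact ⟨-n, by simp [hn]⟩

theorem dual_vectors {k : ℕ} (b : Module.Basis (Fin k) ℝ (Vd d)) :
    ∃ ψ : Fin k → Vd d, ∀ i x, pairE (ψ i) x = b.repr x i := by
  refine ⟨fun i => (InnerProductSpace.toDual ℝ (Vd d)).symm
    (LinearMap.toContinuousLinearMap (b.coord i)), fun i x => ?_⟩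
  unfold pairE
  rw [InnerProductSpace.toDual_symm_apply]
  simp

/-- apply a rational functional to the coordinates. -/
noncomputable def Rmap {k : ℕ} (b : Module.Basis (Fin k) ℝ (Vd d)) (ℓ : ℝ →ₗ[ℚ] ℚ) (x : Vd d) :
    Vd d :=
  ∑ i, ((ℓ (b.repr x i) : ℚ) : ℝ) • b i

theorem Rmap_rat {Λ : AddSubgroup (Vd d)} {k : ℕ} (b : Module.Basis (Fin k) ℝ (Vd d))
    (hb : ∀ i, b i ∈ Λ) (ℓ : ℝ →ₗ[ℚ] ℚ) (x : Vd d) : IsRatPoint Λ (Rmap b ℓ x) := by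
  refine ⟨∏ i, ((ℓ (b.repr x i)).den : ℤ), ?_, ?_⟩
  · rw [Finset.prod_ne_zero_iff]
    intro i _
    exact_mod_cast (ℓ (b.repr x i)).den_nz
  · unfold Rmap
    rw [Finset.smul_sum]
    refine AddSubgroup.sum_mem _ fun i _ => ?_
    rw [← Finset.mul_prod_erase _ _ (Finset.mem_univ i), smul_smul]
    set D : ℤ := ∏ j ∈ Finset.univ.erase i, ((ℓ (b.repr x j)).den : ℤ)
    set q := ℓ (b.repr x i)
    have : ((((q.den : ℤ) * D : ℤ) : ℝ) * (q : ℝ)) = ((D * q.num : ℤ) : ℝ) := by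
      have h1 : (q : ℝ) * (q.den : ℝ) = q.num := by exact_mod_cast Rat.mul_den_eq_num q
      push_cast
      rw [← h1]
      ring
    rw [this, Int.cast_smul_eq_zsmul]
    exact AddSubgroup.zsmul_mem _ (hb i) _

theorem Rmap_pair {Λ : AddSubgroup (Vd d)} {k : ℕ} (b : Module.Basis (Fin k) ℝ (Vd d))
    (hb : ∀ i, b i ∈ Λ) (ℓ : ℝ →ₗ[ℚ] ℚ) (x : Vd d) {φ : Vd d} (hφ : IsDualIntegral Λ φ) :
    pairE φ (Rmap b ℓ x) = ((ℓ (pairE φ x) : ℚ) : ℝ) := by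
  choose n hn using fun i => hφ (b i) (hb i)
  have h1 : pairE φ x = ∑ i, (n i : ℚ) • b.repr x i := by
    conv_lhs => rw [← b.sum_repr x]
    rw [pairE_sum]
    refine Finset.sum_congr rfl fun i _ => ?_
    rw [pairE_smul, hn, Rat.smul_def]
    push_cast
    ring
  rw [h1, map_sum, Rmap, pairE_sum]
  push_cast
  refine Finset.sum_congr rfl fun i _ => ?_
  rw [pairE_smul, hn, map_smul]
  push_cast [smul_eq_mul]
  ring

theorem exists_rat_functional {x : ℝ} (hx : x ≠ 0) : ∃ ℓ : ℝ →ₗ[ℚ] ℚ, ℓ x = 1 := by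
  have := (Module.forall_dual_apply_eq_zero_iff ℚ x).not.2 hx
  push Not at this
  obtain ⟨f, hf⟩ := this
  exact ⟨(f x)⁻¹ • f, by simp [hf]⟩

/-- rational systems with a nonzero solution have a nonzero lattice solution. -/
theorem exists_lattice_solution {Λ : AddSubgroup (Vd d)} (hΛ : IsFullLattice Λ) {ι : Type*}
    (φ : ι → Vd d) (hφ : ∀ i, IsDualIntegral Λ (φ i)) {u : Vd d} (hu : u ≠ 0)
    (h : ∀ i, pairE (φ i) u = 0) : ∃ u' ∈ Λ, u' ≠ 0 ∧ ∀ i, pairE (φ i) u' = 0 := by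
  obtain ⟨k, b, hb, hintg⟩ := lattice_basis hΛ
  obtain ⟨ψ, hψ⟩ := dual_vectors b
  have : ∃ j, b.repr u j ≠ 0 := by
    by_contra hcon
    push Not at hcon
    apply hu
    apply b.repr.injective
    ext j
    simp [hcon j]
  obtain ⟨j, hj⟩ := this
  obtain ⟨ℓ, hℓ⟩ := exists_rat_functional hj
  obtain ⟨q, hq0, hq⟩ := Rmap_rat b hb ℓ u
  have hqr : (q : ℝ) ≠ 0 := by exact_mod_cast hq0
  refine ⟨_, hq, fun h0 => ?_, fun i => ?_⟩
  · have h1 := congrArg (pairE (ψ j)) h0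
    rw [pairE_smul, Rmap_pair b hb ℓ u (φ := ψ j)
      (fun x hx => by rw [hψ]; exact hintg x hx j), pairE_zero, hψ, hℓ] at h1
    simp [hq0] at h1
  · rw [pairE_smul, Rmap_pair b hb ℓ u (hφ i), h]
    simp

theorem ratPoint_of_unique {Λ : AddSubgroup (Vd d)} (hΛ : IsFullLattice Λ) {ι : Type*}
    (φ : ι → Vd d) (hφ : ∀ i, IsDualIntegral Λ (φ i)) (c : ι → ℚ) {w : Vd d}
    (hw : ∀ i, pairE (φ i) w = c i) (huniq : ∀ x, (∀ i, pairE (φ i) x = c i) → x = w) :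
    IsRatPoint Λ w := by
  obtain ⟨k, b, hb, hintg⟩ := lattice_basis hΛ
  obtain ⟨ℓ, hℓ⟩ := exists_rat_functional (x := 1) one_ne_zero
  have : Rmap b ℓ w = w := by
    apply huniq
    intro i
    rw [Rmap_pair b hb ℓ w (hφ i), hw]
    have h2 : ((c i : ℚ) : ℝ) = (c i) • (1 : ℝ) := by rw [Rat.smul_def, mul_one]
    rw [h2, map_smul, hℓ]
    simp
  rw [← this]
  exact Rmap_rat b hb ℓ w

/-- the real solution space of a rational homogeneous system is spanned by lattice vectors. -/
theorem span_solutions {Λ : AddSubgroup (Vd d)} (hΛ : IsFullLattice Λ) {ι : Type*}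
    (φ : ι → Vd d) (hφ : ∀ i, IsDualIntegral Λ (φ i)) {u : Vd d}
    (h : ∀ i, pairE (φ i) u = 0) :
    u ∈ Submodule.span ℝ {x | x ∈ Λ ∧ ∀ i, pairE (φ i) x = 0} := by
  classical
  obtain ⟨k, b, hb, hintg⟩ := lattice_basis hΛ
  set B := Module.Basis.ofVectorSpace ℚ ℝ
  set K := Finset.univ.biUnion (fun i : Fin k => (B.repr (b.repr u i)).support)
  have hx : ∀ i, b.repr u i = ∑ κ ∈ K, ((B.repr (b.repr u i) κ : ℚ) : ℝ) * B κ := by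
    intro i
    conv_lhs => rw [← B.linearCombination_repr (b.repr u i)]
    rw [Finsupp.linearCombination_apply, Finsupp.sum_of_support_subset (s := K)]
    · simp [Rat.smul_def]
    · exact Finset.subset_biUnion_of_mem (fun i : Fin k => (B.repr (b.repr u i)).support)
        (Finset.mem_univ i)
    · simp
  have hu : u = ∑ κ ∈ K, (B κ) • Rmap b (B.coord κ) u := by
    conv_lhs => rw [← b.sum_repr u]
    unfold Rmap
    simp_rw [Finset.smul_sum]
    rw [Finset.sum_comm]
    refine Finset.sum_congr rfl fun i _ => ?_
    rw [hx i, Finset.sum_smul]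
    refine Finset.sum_congr rfl fun κ _ => ?_
    rw [← smul_smul, smul_comm]
    conv_rhs => rw [← hx i]
    rfl
  rw [hu]
  refine Submodule.sum_mem _ fun κ _ => Submodule.smul_mem _ _ ?_
  obtain ⟨q, hq0, hq⟩ := Rmap_rat b hb (B.coord κ) u
  have hqr : (q : ℝ) ≠ 0 := by exact_mod_cast hq0
  have : Rmap b (B.coord κ) u = (q : ℝ)⁻¹ • ((q : ℝ) • Rmap b (B.coord κ) u) := by
    rw [smul_smul, inv_mul_cancel₀ hqr, one_smul]
  rw [this]
  refine Submodule.smul_mem _ _ (Submodule.subset_span ⟨hq, fun i => ?_⟩)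
  rw [pairE_smul, Rmap_pair b hb _ u (hφ i), h]
  simp

open scoped NNReal in
theorem cone_step (φ : Vd d) {s : Set (Vd d)} {x : Vd d}
    (hx : x ∈ Submodule.span ℝ≥0 s) (hφx : pairE φ x ≤ 0) :
    x ∈ Submodule.span ℝ≥0 ({g | g ∈ s ∧ pairE φ g ≤ 0} ∪
      (Set.image2 (fun g g' => pairE φ g • g' - pairE φ g' • g) {g | g ∈ s ∧ 0 < pairE φ g}
        {g | g ∈ s ∧ pairE φ g ≤ 0})) := by
  set sp := {g | g ∈ s ∧ 0 < pairE φ g}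
  set sm := {g | g ∈ s ∧ pairE φ g ≤ 0}
  set s' := sm ∪ Set.image2 (fun g g' => pairE φ g • g' - pairE φ g' • g) sp sm
  have hs : s = sp ∪ sm := by
    ext g
    simp only [sp, sm, Set.mem_union, Set.mem_ofPred_eq]
    constructor
    · intro hg
      rcases lt_or_ge 0 (pairE φ g) with h | h
      exacts [Or.inl ⟨hg, h⟩, Or.inr ⟨hg, h⟩]
    · rintro (h | h) <;> exact h.1
  rw [hs, Submodule.span_union, Submodule.mem_sup] at hx
  obtain ⟨z, hz, w, hw, rfl⟩ := hx
  have hmix : ∀ z ∈ Submodule.span ℝ≥0 sp, ∀ w ∈ Submodule.span ℝ≥0 sm,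
      pairE φ z • w - pairE φ w • z ∈ Submodule.span ℝ≥0 s' := by
    intro z hz w hw
    induction hz using Submodule.span_induction with
    | mem z hz =>
      induction hw using Submodule.span_induction with
      | mem w hw => exact Submodule.subset_span (Or.inr ⟨z, hz, w, hw, rfl⟩)
      | zero => simp [pairE_zero]
      | add a b _ _ ha hb =>
        convert add_mem ha hb using 1
        rw [pairE_add]; module
      | smul t a _ ha =>
        convert Submodule.smul_mem _ t ha using 1
        rw [NNReal.smul_def, NNReal.smul_def, pairE_smul]; module
    | zero => simp [pairE_zero]
    | add a b _ _ ha hb =>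
      convert add_mem ha hb using 1
      rw [pairE_add]; module
    | smul t a _ ha =>
      convert Submodule.smul_mem _ t ha using 1
      rw [NNReal.smul_def, NNReal.smul_def, pairE_smul]; module
  have hzpos : z = 0 ∨ 0 < pairE φ z := by
    clear hφx
    induction hz using Submodule.span_induction with
    | mem z hz => exact Or.inr hz.2
    | zero => exact Or.inl rfl
    | add a b _ _ ha hb =>
      rw [pairE_add]
      rcases ha with rfl | ha
      · simpa [pairE_zero] using hb
      · rcases hb with rfl | hb
        · right; simpa [pairE_zero] using ha
        · right; linarith
    | smul t a _ ha =>
      rcases ha with rfl | ha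
      · simp
      · rcases eq_or_ne t 0 with rfl | ht
        · simp
        · right
          rw [NNReal.smul_def, pairE_smul]
          exact mul_pos (by exact_mod_cast pos_iff_ne_zero.2 ht) ha
  have hw' : w ∈ Submodule.span ℝ≥0 s' := Submodule.span_mono Set.subset_union_left hw
  rcases hzpos with rfl | hpos
  · simpa using hw'
  · rw [pairE_add] at hφx
    set α := pairE φ z with hα
    set β := - pairE φ w with hβ
    have hβ0 : 0 < β := by linarith
    have h1 : z + w = (⟨1 - α / β, by
        rw [sub_nonneg, div_le_one hβ0]; linarith⟩ : ℝ≥0) • w +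
        (⟨1 / β, by positivity⟩ : ℝ≥0) • (pairE φ z • w - pairE φ w • z) := by
      change z + w = (1 - α / β) • w + (1 / β) • (α • w - pairE φ w • z)
      have h3 : pairE φ w = - β := by rw [hβ]; ring
      rw [h3]
      match_scalars <;> field_simp
      ring
    rw [h1]
    exact add_mem (Submodule.smul_mem _ _ hw') (Submodule.smul_mem _ _ (hmix z hz w hw))

open scoped NNReal in
/-- a rational polyhedral cone is generated by finitely many lattice vectors. -/
theorem cone_generated {Λ : AddSubgroup (Vd d)} (hΛ : IsFullLattice Λ) {ι : Type*}
    (φ : ι → Vd d) (hφ : ∀ i, IsDualIntegral Λ (φ i)) (J : Finset ι) :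
    ∃ s : Set (Vd d), s.Finite ∧ s ⊆ Λ ∧
      (Submodule.span ℝ≥0 s : Set (Vd d)) = {x | ∀ i ∈ J, pairE (φ i) x ≤ 0} := by
  classical
  induction J using Finset.induction_on with
  | empty =>
    obtain ⟨k, b, hb, hintg⟩ := lattice_basis hΛ
    refine ⟨Set.range b ∪ Set.range (fun i => - b i),
      (Set.finite_range _).union (Set.finite_range _), ?_, ?_⟩
    · rintro _ (⟨i, rfl⟩ | ⟨i, rfl⟩)
      exacts [hb i, neg_mem (hb i)]
    · ext x
      simp only [Finset.notMem_empty, false_implies, implies_true, SetLike.mem_coe]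
      refine iff_of_true ?_ trivial
      rw [← b.sum_repr x]
      refine Submodule.sum_mem _ fun i _ => ?_
      rcases le_total 0 (b.repr x i) with h | h
      · have : (b.repr x i) • b i = (⟨b.repr x i, h⟩ : ℝ≥0) • b i := rfl
        rw [this]
        exact Submodule.smul_mem _ _ (Submodule.subset_span (Or.inl ⟨i, rfl⟩))
      · have : (b.repr x i) • b i = (⟨-b.repr x i, by linarith⟩ : ℝ≥0) • (-b i) := by
          change _ = (- b.repr x i) • (- b i)
          simp
        rw [this]
        exact Submodule.smul_mem _ _ (Submodule.subset_span (Or.inr ⟨i, rfl⟩))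
  | insert j J hj ih =>
    obtain ⟨s, hsf, hsΛ, hs⟩ := ih
    refine ⟨({g | g ∈ s ∧ pairE (φ j) g ≤ 0} ∪
      (Set.image2 (fun g g' => pairE (φ j) g • g' - pairE (φ j) g' • g)
        {g | g ∈ s ∧ 0 < pairE (φ j) g} {g | g ∈ s ∧ pairE (φ j) g ≤ 0})), ?_, ?_, ?_⟩
    · exact (hsf.subset fun x h => h.1).union
        ((hsf.subset fun x h => h.1).image2 _ (hsf.subset fun x h => h.1))
    · rintro _ (h | ⟨g, hg, g', hg', rfl⟩)
      · exact hsΛ h.1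
      · obtain ⟨n, hn⟩ := hφ j g (hsΛ hg.1)
        obtain ⟨m, hm⟩ := hφ j g' (hsΛ hg'.1)
        simp only [hn, hm, Int.cast_smul_eq_zsmul]
        exact sub_mem (zsmul_mem (hsΛ hg'.1) _) (zsmul_mem (hsΛ hg.1) _)
    · apply Set.Subset.antisymm
      · intro x hx
        rw [SetLike.mem_coe] at hx
        have hgen : ∀ g ∈ s, ∀ i ∈ J, pairE (φ i) g ≤ 0 := by
          intro g hg
          have : g ∈ (Submodule.span ℝ≥0 s : Set (Vd d)) := Submodule.subset_span hg
          rw [hs] at this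
          exact this
        intro i hi
        induction hx using Submodule.span_induction with
        | mem x hx =>
          rw [Finset.mem_insert] at hi
          rcases hx with hx | ⟨g, hg, g', hg', rfl⟩
          · rcases hi with rfl | hi
            exacts [hx.2, hgen x hx.1 i hi]
          · simp only [pairE_sub, pairE_smul]
            rcases hi with rfl | hi
            · nlinarith
            · have h1 := hgen g hg.1 i hi
              have h2 := hgen g' hg'.1 i hi
              have h3 := hg.2
              have h4 := hg'.2
              nlinarith [mul_nonneg h3.le (neg_nonneg.2 h2),
                mul_nonneg (neg_nonneg.2 h4) (neg_nonneg.2 h1)]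
        | zero => rw [pairE_zero]
        | add a b _ _ ha hb => rw [pairE_add]; linarith
        | smul t a _ ha =>
          rw [NNReal.smul_def, pairE_smul]
          exact mul_nonpos_of_nonneg_of_nonpos t.2 ha
      · intro x hx
        refine cone_step (φ j) (s := s) ?_ (hx j (by simp))
        have : x ∈ (Submodule.span ℝ≥0 s : Set (Vd d)) := by
          rw [hs]
          exact fun i hi => hx i (by simp [hi])
        exact this

open scoped NNReal in
/-- the tangent cone of a rational polyhedron at a vertex is a rational affine cone. -/
theorem ratAffineCone_tanC {Λ : AddSubgroup (Vd d)} (hΛ : IsFullLattice Λ) {P : Set (Vd d)}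
    (hP : IsRatPolyhedron Λ P) {w : Vd d} (hw : w ∈ P) (hl : ¬ ContainsLine (tanC P w)) :
    IsRatAffineCone Λ (tanC P w) := by
  classical
  obtain ⟨n, φ, c, h, rfl⟩ := ratPoly_exists hΛ hP
  rw [tanC_hpoly _ _ hw] at hl ⊢
  have hrat : IsRatPoint Λ w := by
    refine ratPoint_of_unique hΛ (fun i : {i // pairE (φ i) w = c i} => φ i) (fun i => h i)
      (fun i => c i) (fun i => i.2) fun x hx => ?_
    by_contra hne
    apply hl
    refine ⟨w, x - w, sub_ne_zero.2 hne, fun t i hi => ?_⟩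
    rw [pairE_add, pairE_smul, pairE_sub, hx ⟨i, hi⟩, hi]
    simp
  obtain ⟨s, hsf, hsΛ, hs⟩ := cone_generated hΛ φ h (Finset.univ.filter
    fun i => pairE (φ i) w = c i)
  obtain ⟨m, ⟨e⟩⟩ := hsf.exists_equiv_fin
  refine ⟨w, m, fun i => (e.symm i : Vd d), hrat, fun i => hsΛ (e.symm i).2, ?_⟩
  have hrange : s = Set.range (fun i => (e.symm i : Vd d)) := by
    ext x
    constructor
    · intro hx
      exact ⟨e ⟨x, hx⟩, by simp⟩
    · rintro ⟨i, rfl⟩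
      exact (e.symm i).2
  have key : ∀ x, (x ∈ {x | ∀ i, pairE (φ i) w = c i → pairE (φ i) x ≤ (c i : ℝ)} ↔
      x - w ∈ (Submodule.span ℝ≥0 s : Set (Vd d))) := by
    intro x
    rw [hs]
    simp only [Set.mem_ofPred_eq, Finset.mem_filter, Finset.mem_univ, true_and]
    refine forall_congr' fun i => forall_congr' fun hi => ?_
    rw [pairE_sub, hi, sub_nonpos]
  have hspan : Submodule.span ℝ≥0 s =
      Submodule.span ℝ≥0 (Set.range (fun i => (e.symm i : Vd d))) := congrArg _ hrange
  ext x
  rw [key, SetLike.mem_coe, hspan, Submodule.mem_span_range_iff_exists_fun]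
  constructor
  · rintro ⟨t, ht⟩
    refine ⟨fun i => t i, fun i => (t i).2, ?_⟩
    rw [← sub_eq_iff_eq_add', ← ht]
    rfl
  · rintro ⟨t, ht, rfl⟩
    refine ⟨fun i => ⟨t i, ht i⟩, ?_⟩
    rw [add_sub_cancel_left]
    rfl

end Rational

section Valuation

variable {d : ℕ}

/-- the real-valued indicator function of a set. -/
noncomputable def ind (P : Set (Vd d)) : Vd d → ℝ := P.indicator 1

open Classical in
theorem ind_apply (P : Set (Vd d)) (x : Vd d) : ind P x = if x ∈ P then 1 else 0 := by
  simp [ind, Set.indicator]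

theorem ind_inter (P P' : Set (Vd d)) (x : Vd d) : ind (P ∩ P') x = ind P x * ind P' x := by
  classical
  simp only [ind_apply, Set.mem_inter_iff]
  split_ifs <;> simp_all

/-- data of an exponential valuation attached to a measure `ν` carried by `A`. -/
structure ValData (Λ : AddSubgroup (Vd d)) (A : AffineSubspace ℝ (Vd d)) (ν : Measure (Vd d))
    (T : Set (Vd d) → Vd d → ℝ) : Prop where
  mer : ∀ P, IsRatPolyhedron Λ P → Mer (T P)
  val : ∀ P, IsRatPolyhedron Λ P → ∀ ξ, IntegrableOn (fun x => Real.exp (pairE ξ x)) P ν →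
    T P ξ = ∫ x in P, Real.exp (pairE ξ x) ∂ν
  dec : ∃ r : ℕ, Integrable (fun x => ((1 + ‖x‖) ^ r)⁻¹) ν
  inv : ∀ u ∈ Λ, u ∈ A.direction → MeasurePreserving (fun x => x + u) ν ν

theorem exp_decay (r : ℕ) {b : ℝ} (hb : 0 < b) : ∃ C : ℝ, ∀ t : ℝ, 0 ≤ t →
    Real.exp (-(b * t)) ≤ C * ((1 + t) ^ r)⁻¹ := by
  refine ⟨Real.exp b * r.factorial / b ^ r, fun t ht => ?_⟩
  have h := Real.pow_div_factorial_le_exp (b * (1 + t)) (by positivity) r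
  rw [div_le_iff₀ (by positivity), mul_pow] at h
  have h2 : Real.exp (-(b * t)) = Real.exp b * (Real.exp (b * (1 + t)))⁻¹ := by
    rw [← Real.exp_neg, ← Real.exp_add]; ring_nf
  rw [h2, div_mul_eq_mul_div, mul_assoc, mul_div_assoc]
  refine mul_le_mul_of_nonneg_left ?_ (Real.exp_pos _).le
  rw [← div_eq_mul_inv, inv_eq_one_div, div_div, div_le_div_iff₀ (by positivity) (by positivity)]
  linarith

/-- the exponential integral over a pointed polyhedron converges on an open set of
parameters adherent to `0`. -/
theorem conv_domain {Λ : AddSubgroup (Vd d)} (hΛ : IsFullLattice Λ) {D : Set (Vd d)}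
    (hD : IsRatPolyhedron Λ D) (hl : ¬ ContainsLine D) {ν : Measure (Vd d)}
    (dec : ∃ r : ℕ, Integrable (fun x : Vd d => ((1 + ‖x‖) ^ r)⁻¹) ν) :
    ∃ Ω : Set (Vd d), IsOpen Ω ∧ (0 : Vd d) ∈ closure Ω ∧
      ∀ ξ ∈ Ω, IntegrableOn (fun x => Real.exp (pairE ξ x)) D ν := by
  rcases D.eq_empty_or_nonempty with rfl | ⟨x0, hx0⟩
  · exact ⟨Set.univ, isOpen_univ, by simp, fun ξ _ => by simp⟩
  have hmeas := (ratPoly_closed hΛ hD).measurableSet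
  obtain ⟨n, φ, c, hintg, rfl⟩ := ratPoly_exists hΛ hD
  have hsep : ∀ u : Vd d, (∀ i, pairE (φ i) u = 0) → u = 0 := by
    intro u hu
    by_contra hne
    refine hl ⟨x0, u, hne, fun t i => ?_⟩
    rw [pairE_add, pairE_smul, hu, mul_zero, add_zero]
    exact hx0 i
  let L : (Fin n → ℝ) →ₗ[ℝ] Vd d := Fintype.linearCombination ℝ φ
  have hL : ∀ a, L a = ∑ i, a i • φ i := fun a => Fintype.linearCombination_apply ℝ φ a
  have hsurj : Function.Surjective L := by
    rw [← LinearMap.range_eq_top, ← Submodule.orthogonal_eq_bot_iff, Submodule.eq_bot_iff]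
    intro u hu
    apply hsep
    intro i
    rw [Submodule.mem_orthogonal] at hu
    refine hu (φ i) ⟨Pi.single i 1, ?_⟩
    rw [hL, Finset.sum_eq_single i]
    · simp
    · intro j _ hj
      simp [hj]
    · simp
  let M : Vd d →ₗ[ℝ] (Fin n → ℝ) := LinearMap.pi fun i => pairL (φ i)
  have hMker : LinearMap.ker M = ⊥ := by
    rw [LinearMap.ker_eq_bot']
    intro u hu
    exact hsep u fun i => congrFun hu i
  obtain ⟨K, hK, hanti⟩ := M.exists_antilipschitzWith hMker
  have hnorm : ∀ x : Vd d, ‖x‖ ≤ K * ∑ i, |pairE (φ i) x| := by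
    intro x
    have h1 := hanti.le_mul_dist x 0
    rw [dist_zero_right, map_zero, dist_zero_right] at h1
    refine h1.trans (mul_le_mul_of_nonneg_left ?_ K.2)
    rw [pi_norm_le_iff_of_nonneg (Finset.sum_nonneg fun i _ => abs_nonneg _)]
    intro i
    exact Finset.single_le_sum (f := fun i => |pairE (φ i) x|) (fun i _ => abs_nonneg _)
      (Finset.mem_univ i)
  refine ⟨L '' {a | ∀ i, 0 < a i}, ?_, ?_, ?_⟩
  · apply L.isOpenMap_of_finiteDimensional hsurj
    have : {a : Fin n → ℝ | ∀ i, 0 < a i} = Set.pi Set.univ fun _ => Set.Ioi 0 := by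
      ext a; simp
    rw [this]
    exact isOpen_set_pi Set.finite_univ fun _ _ => isOpen_Ioi
  · have h0 : (0 : Fin n → ℝ) ∈ closure {a : Fin n → ℝ | ∀ i, 0 < a i} := by
      have : {a : Fin n → ℝ | ∀ i, 0 < a i} = Set.pi Set.univ fun _ => Set.Ioi 0 := by
        ext a; simp
      rw [this, closure_pi_set]
      intro i _
      simp
    have := image_closure_subset_closure_image (s := {a : Fin n → ℝ | ∀ i, 0 < a i})
      L.continuous_of_finiteDimensional ⟨0, h0, rfl⟩
    rwa [map_zero] at this
  · rintro _ ⟨a, ha, rfl⟩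
    rw [Set.mem_ofPred_eq] at ha
    obtain ⟨δ, hδ, hδa⟩ : ∃ δ : ℝ, 0 < δ ∧ ∀ i, δ ≤ a i := by
      rcases isEmpty_or_nonempty (Fin n) with h | h
      · exact ⟨1, one_pos, fun i => isEmptyElim i⟩
      · obtain ⟨i, hi⟩ := Finite.exists_min a
        exact ⟨a i, ha i, hi⟩
    obtain ⟨r, hr⟩ := dec
    have hK' : (0 : ℝ) < K := hK
    obtain ⟨C, hC⟩ := exp_decay r (b := δ / K) (by positivity)
    have hpair : ∀ x, pairE (L a) x = ∑ i, a i * pairE (φ i) x := by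
      intro x
      rw [hL, pairE_comm, pairE_sum]
      refine Finset.sum_congr rfl fun i _ => ?_
      rw [pairE_smul, pairE_comm]
    set B := ∑ i, a i * (2 * |(c i : ℝ)|) with hB
    refine Integrable.mono' (((hr.const_mul C).const_mul (Real.exp B)).integrableOn) ?_ ?_
    · exact (Real.continuous_exp.comp (pairE_continuous _)).aestronglyMeasurable
    · rw [ae_restrict_iff' hmeas]
      refine Filter.Eventually.of_forall fun x hx => ?_
      rw [Real.norm_eq_abs, Real.abs_exp]
      have hx' : pairE (L a) x ≤ B + -(δ / K * ‖x‖) := by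
        have h1 : δ / K * ‖x‖ ≤ δ * ∑ i, |pairE (φ i) x| := by
          calc δ / K * ‖x‖ ≤ δ / K * (K * ∑ i, |pairE (φ i) x|) :=
                mul_le_mul_of_nonneg_left (hnorm x) (by positivity)
            _ = _ := by field_simp
        have h2 : δ * ∑ i, |pairE (φ i) x| ≤ B - pairE (L a) x := by
          rw [hB, hpair, Finset.mul_sum, ← Finset.sum_sub_distrib]
          refine Finset.sum_le_sum fun i _ => ?_
          have h3 : |pairE (φ i) x| ≤ 2 * |(c i : ℝ)| - pairE (φ i) x := by
            have h4 : pairE (φ i) x ≤ c i := hx i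
            have h5 := le_abs_self (c i : ℝ)
            have h6 := abs_nonneg (c i : ℝ)
            rw [abs_le]
            constructor <;> linarith
          calc δ * |pairE (φ i) x| ≤ a i * |pairE (φ i) x| :=
                mul_le_mul_of_nonneg_right (hδa i) (abs_nonneg _)
            _ ≤ a i * (2 * |(c i : ℝ)| - pairE (φ i) x) :=
                mul_le_mul_of_nonneg_left h3 (ha i).le
            _ = _ := by ring
        linarith
      calc Real.exp (pairE (L a) x) ≤ Real.exp (B + -(δ / K * ‖x‖)) := Real.exp_le_exp.2 hx'
        _ = Real.exp B * Real.exp (-(δ / K * ‖x‖)) := Real.exp_add _ _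
        _ ≤ _ := mul_le_mul_of_nonneg_left (hC _ (norm_nonneg _)) (Real.exp_pos _).le

/-- linear relations between pieces of a pointed polyhedron are respected. -/
theorem ValData.rel {Λ : AddSubgroup (Vd d)} (hΛ : IsFullLattice Λ)
    {A : AffineSubspace ℝ (Vd d)} {ν : Measure (Vd d)} {T : Set (Vd d) → Vd d → ℝ}
    (hT : ValData Λ A ν T) {D : Set (Vd d)} (hD : IsRatPolyhedron Λ D) (hl : ¬ ContainsLine D)
    {ι : Type*} (s : Finset ι) (c : ι → ℝ) (P : ι → Set (Vd d))
    (hP : ∀ i ∈ s, IsRatPolyhedron Λ (P i)) (hPD : ∀ i ∈ s, P i ⊆ D)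
    (hrel : ∀ x, ∑ i ∈ s, c i * ind (P i) x = 0) :
    ∑ i ∈ s, c i • toG (T (P i)) = 0 := by
  obtain ⟨Ω, hΩ, h0, hintg⟩ := conv_domain hΛ hD hl hT.dec
  have key : (fun ξ => ∑ i ∈ s, c i * T (P i) ξ) =ᶠ[meroFilter d] 0 := by
    refine Mer.eq_zero (Mer.sum s fun i hi => (hT.mer _ (hP i hi)).const_mul _) hΩ h0 ?_
    intro ξ hξ
    have hi1 : ∀ i ∈ s, IntegrableOn (fun x => Real.exp (pairE ξ x)) (P i) ν :=
      fun i hi => (hintg ξ hξ).mono_set (hPD i hi)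
    have hm : ∀ i ∈ s, MeasurableSet (P i) := fun i hi =>
      (ratPoly_closed hΛ (hP i hi)).measurableSet
    calc ∑ i ∈ s, c i * T (P i) ξ
        = ∑ i ∈ s, ∫ x, c i * (P i).indicator (fun x => Real.exp (pairE ξ x)) x ∂ν := by
          refine Finset.sum_congr rfl fun i hi => ?_
          rw [integral_const_mul, integral_indicator (hm i hi), hT.val _ (hP i hi) ξ (hi1 i hi)]
      _ = ∫ x, ∑ i ∈ s, c i * (P i).indicator (fun x => Real.exp (pairE ξ x)) x ∂ν := by
          rw [integral_finsetSum]
          intro i hi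
          exact ((integrable_indicator_iff (hm i hi)).2 (hi1 i hi)).const_mul _
      _ = ∫ x, 0 ∂ν := by
          congr 1
          ext x
          have : ∀ i ∈ s, c i * (P i).indicator (fun x => Real.exp (pairE ξ x)) x =
              c i * ind (P i) x * Real.exp (pairE ξ x) := by
            classical
            intro i _
            rw [ind_apply, Set.indicator_apply]
            split_ifs <;> simp
          rw [Finset.sum_congr rfl this, ← Finset.sum_mul, hrel, zero_mul]
      _ = 0 := by simp
  have h := toG_eq.2 key
  rw [toG_sum] at h
  exact h

/-- translation by a lattice vector multiplies by an exponential. -/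
theorem ValData.translate {Λ : AddSubgroup (Vd d)} (hΛ : IsFullLattice Λ)
    {A : AffineSubspace ℝ (Vd d)} {ν : Measure (Vd d)} {T : Set (Vd d) → Vd d → ℝ}
    (hT : ValData Λ A ν T) {D : Set (Vd d)} (hD : IsRatPolyhedron Λ D) (hl : ¬ ContainsLine D)
    {u : Vd d} (hu : u ∈ Λ) (huA : u ∈ A.direction) :
    toG (T ((fun x => x + u) '' D)) = toG (fun ξ => Real.exp (pairE ξ u)) * toG (T D) := by
  obtain ⟨Ω, hΩ, h0, hintg⟩ := conv_domain hΛ hD hl hT.dec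
  have han : AnalyticAt ℝ (fun ξ : Vd d => Real.exp (pairE ξ u)) 0 := by
    have h1 : AnalyticAt ℝ (fun ξ : Vd d => pairE ξ u) 0 := by
      have : (fun ξ : Vd d => pairE ξ u) = innerSL ℝ u := by
        ext ξ; rw [innerSL_apply_apply, pairE_comm]; rfl
      rw [this]
      exact (innerSL ℝ u).analyticAt 0
    exact h1.rexp
  have hDu := ratPoly_translate hΛ hD hu
  have hpres := hT.inv u hu huA
  have hemb : MeasurableEmbedding (fun x : Vd d => x + u) := measurableEmbedding_addRight u
  have key : (fun ξ => T ((fun x => x + u) '' D) ξ + (-1) * (Real.exp (pairE ξ u) * T D ξ))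
      =ᶠ[meroFilter d] 0 := by
    refine Mer.eq_zero ((hT.mer _ hDu).add (((hT.mer _ hD).analytic_mul han).const_mul _))
      hΩ h0 ?_
    intro ξ hξ
    have hfun : ∀ x, Real.exp (pairE ξ (x + u)) = Real.exp (pairE ξ u) * Real.exp (pairE ξ x) := by
      intro x
      rw [pairE_add, Real.exp_add, mul_comm]
    have hint2 : IntegrableOn (fun x => Real.exp (pairE ξ x)) ((fun x => x + u) '' D) ν := by
      rw [hpres.integrableOn_image hemb]
      have : ((fun x => Real.exp (pairE ξ x)) ∘ fun x => x + u) =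
        fun x => Real.exp (pairE ξ u) * Real.exp (pairE ξ x) := funext hfun
      rw [this]
      exact (hintg ξ hξ).const_mul _
    rw [hT.val _ hDu ξ hint2, hT.val _ hD ξ (hintg ξ hξ), hpres.setIntegral_image_emb hemb]
    simp only [hfun]
    rw [integral_const_mul]
    ring
  rw [← toG_mul, toG_eq]
  filter_upwards [key] with ξ hξ
  have : T ((fun x => x + u) '' D) ξ + (-1) * (Real.exp (pairE ξ u) * T D ξ) = 0 := hξ
  linarith

/-- generalized orthants: a decomposition of the constant function `1` into indicator
functions of pointed rational polyhedra. -/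
theorem orthants {Λ : AddSubgroup (Vd d)} (hΛ : IsFullLattice Λ) :
    ∃ (k : ℕ) (O : (Fin k → Fin 3) → Set (Vd d)) (s : (Fin k → Fin 3) → ℝ),
      (∀ σ, IsRatPolyhedron Λ (O σ)) ∧ (∀ σ, ¬ ContainsLine (O σ)) ∧
      ∀ x, ∑ σ, s σ * ind (O σ) x = 1 := by
  classical
  obtain ⟨k, b, hb, hintg⟩ := lattice_basis hΛ
  obtain ⟨ψ, hψ⟩ := dual_vectors b
  have hψint : ∀ i, IsDualIntegral Λ (ψ i) := by
    intro i x hx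
    obtain ⟨n, hn⟩ := hintg x hx i
    exact ⟨n, by rw [hψ, hn]⟩
  let e : Fin 3 → Bool → ℤ := fun j t => if j = 0 then -1 else if j = 1 then 1 else
    if t then 1 else -1
  let f : (Fin k → Fin 3) → (Fin k × Bool) → Vd d := fun σ p => (e (σ p.1) p.2 : ℝ) • ψ p.1
  have hf : ∀ σ p x, pairE (f σ p) x = e (σ p.1) p.2 * pairE (ψ p.1) x := by
    intro σ p x
    simp only [f]
    rw [pairE_comm, pairE_smul, pairE_comm]
  let s : Fin 3 → ℝ := ![1, 1, -1]
  refine ⟨k, fun σ => hpoly (f σ) 0, fun σ => ∏ i, s (σ i), ?_, ?_, ?_⟩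
  · intro σ
    refine ratPoly_of hΛ _ _ fun p x hx => ?_
    obtain ⟨n, hn⟩ := hψint p.1 x hx
    exact ⟨e (σ p.1) p.2 * n, by rw [hf, hn]; push_cast; rfl⟩
  · rintro σ ⟨x, u, hu, h⟩
    apply hu
    have : ∀ i, pairE (ψ i) u = 0 := by
      intro i
      have h1 := hpoly_line_iff _ _ h (i, true)
      rw [hf] at h1
      have h2 : e (σ i) true ≠ 0 := by
        simp only [e]
        split_ifs <;> simp
      have h3 : ((e (σ i) true : ℤ) : ℝ) ≠ 0 := by exact_mod_cast h2
      exact (mul_eq_zero.1 h1).resolve_left h3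
    apply b.repr.injective
    ext i
    rw [← hψ, this]
    simp
  · intro x
    let R : Fin 3 → ℝ → ℝ := fun j y => if ∀ t, e j t * y ≤ 0 then 1 else 0
    have hR : ∀ y, ∑ j, s j * R j y = 1 := by
      intro y
      rw [Fin.sum_univ_three]
      simp only [s, R, e]
      simp
      rcases lt_trichotomy y 0 with h | h | h
      · simp [h.le, h.not_ge]
      · simp [h]
      · simp [h.le, h.not_ge]
    have hO : ∀ σ, ind (hpoly (f σ) 0) x = ∏ i, R (σ i) (pairE (ψ i) x) := by
      intro σ
      rw [ind_apply]
      simp only [R]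
      rw [Finset.prod_ite_zero]
      simp only [Finset.prod_const_one]
      congr 1
      simp only [hpoly, hf, Set.mem_ofPred_eq, Finset.mem_univ, true_implies, eq_iff_iff]
      simp
    simp only [hO, ← Finset.prod_mul_distrib]
    have h := Finset.prod_univ_sum (fun _ : Fin k => (Finset.univ : Finset (Fin 3)))
      (fun i j => s j * R j (pairE (ψ i) x))
    rw [Fintype.piFinset_univ] at h
    rw [← h]
    simp [hR]

end Valuation

section Brion

variable {d : ℕ}

theorem ContainsLine.mono {P P' : Set (Vd d)} (h : P ⊆ P') (hl : ContainsLine P) :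
    ContainsLine P' := by
  obtain ⟨x, u, hu, h'⟩ := hl
  exact ⟨x, u, hu, fun t => h (h' t)⟩

theorem exp_ne_one_eventually {u : Vd d} (hu : u ≠ 0) :
    ∀ᶠ ξ in meroFilter d, Real.exp (pairE ξ u) - 1 ≠ 0 := by
  apply eventually_ne_of_analytic
  · have h1 : AnalyticAt ℝ (fun ξ : Vd d => pairE ξ u) 0 := by
      have : (fun ξ : Vd d => pairE ξ u) = innerSL ℝ u := by
        ext ξ; rw [innerSL_apply_apply, pairE_comm]; rfl
      rw [this]
      exact (innerSL ℝ u).analyticAt 0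
    exact h1.rexp.sub analyticAt_const
  · intro h
    have ht : Tendsto (fun t : ℝ => t • u) (𝓝[>] 0) (𝓝 0) := by
      have : Tendsto (fun t : ℝ => t • u) (𝓝 0) (𝓝 ((0 : ℝ) • u)) :=
        (continuous_id.smul continuous_const).tendsto 0
      rw [zero_smul] at this
      exact this.mono_left nhdsWithin_le_nhds
    obtain ⟨t, ht1, ht2⟩ := ((ht.eventually h).and self_mem_nhdsWithin).exists
    rw [sub_eq_zero, Real.exp_eq_one_iff, pairE_comm, pairE_smul] at ht1
    have h3 : pairE u u ≠ 0 := by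
      unfold pairE
      rw [real_inner_self_eq_norm_sq]
      exact pow_ne_zero _ (norm_ne_zero_iff.2 hu)
    exact (mul_ne_zero (ne_of_gt ht2) h3) ht1

theorem germ_mul_smul (e : MGerm d) (c : ℝ) (g : MGerm d) : e * (c • g) = c • (e * g) := by
  induction e using Germ.inductionOn with
  | _ e =>
  induction g using Germ.inductionOn with
  | _ g =>
  refine Germ.coe_eq.2 (Filter.Eventually.of_forall fun ξ => ?_)
  change e ξ * (c * g ξ) = c * (e ξ * g ξ)
  ring

theorem ind_image (P : Set (Vd d)) (u x : Vd d) :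
    ind ((fun x => x + u) '' P) x = ind P (x - u) := by
  classical
  rw [ind_apply, ind_apply]
  congr 1
  simp only [Set.mem_image, eq_iff_iff]
  constructor
  · rintro ⟨y, hy, rfl⟩
    simpa using hy
  · intro h
    exact ⟨x - u, h, by simp⟩

/-- the exponential valuation extends to a linear map on the algebra of polyhedra which kills
the polyhedra containing lines. -/
theorem ValData.exists_linear {Λ : AddSubgroup (Vd d)} (hΛ : IsFullLattice Λ)
    {A : AffineSubspace ℝ (Vd d)} {ν : Measure (Vd d)} {T : Set (Vd d) → Vd d → ℝ}
    (hT : ValData Λ A ν T) :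
    ∃ Φ : (Vd d → ℝ) →ₗ[ℝ] MGerm d,
      (∀ P, IsRatPolyhedron Λ P → ¬ ContainsLine P → Φ (ind P) = toG (T P)) ∧
      (∀ P, IsRatPolyhedron Λ P → P ⊆ A → ContainsLine P → Φ (ind P) = 0) := by
  classical
  obtain ⟨k, O, s, hO, hOl, hsum⟩ := orthants hΛ
  have hPO : ∀ P, IsRatPolyhedron Λ P → ∀ σ, IsRatPolyhedron Λ (P ∩ O σ) :=
    fun P hP σ => ratPoly_inter hΛ hP (hO σ)
  have hPOl : ∀ P : Set (Vd d), ∀ σ, ¬ ContainsLine (P ∩ O σ) :=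
    fun P σ h => hOl σ (h.mono Set.inter_subset_right)
  obtain ⟨Φ, hΦ⟩ := exists_linear_of_relations
    (fun P : {P : Set (Vd d) // IsRatPolyhedron Λ P} => ind P.1)
    (fun P => ∑ σ, s σ • toG (T (P.1 ∩ O σ))) (by
      intro J c hrel
      simp only [Finset.smul_sum]
      rw [Finset.sum_comm]
      refine Finset.sum_eq_zero fun σ _ => ?_
      have : ∀ P ∈ J, c P • s σ • toG (T (P.1 ∩ O σ)) = s σ • c P • toG (T (P.1 ∩ O σ)) :=
        fun P _ => smul_comm _ _ _
      rw [Finset.sum_congr rfl this, ← Finset.smul_sum]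
      rw [hT.rel hΛ (hO σ) (hOl σ) J c (fun P => P.1 ∩ O σ) (fun P _ => hPO _ P.2 σ)
        (fun P _ => Set.inter_subset_right), smul_zero]
      intro x
      have h1 := congrFun hrel x
      simp only [Finset.sum_apply, Pi.smul_apply, smul_eq_mul, Pi.zero_apply] at h1
      simp only [ind_inter, ← mul_assoc]
      rw [← Finset.sum_mul, h1, zero_mul])
  have hpt : ∀ P, IsRatPolyhedron Λ P → ¬ ContainsLine P → Φ (ind P) = toG (T P) := by
    intro P hP hl
    have := hT.rel hΛ hP hl (Finset.univ : Finset (Option (Fin k → Fin 3)))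
      (fun o => o.elim (-1) s) (fun o => o.elim P (fun σ => P ∩ O σ)) (by
        rintro (_ | σ) _
        exacts [hP, hPO P hP σ]) (by
        rintro (_ | σ) _
        exacts [subset_rfl, Set.inter_subset_left]) (by
        intro x
        rw [Fintype.sum_option]
        simp only [Option.elim, ind_inter]
        have h1 : ∀ σ, s σ * (ind P x * ind (O σ) x) = ind P x * (s σ * ind (O σ) x) :=
          fun σ => by ring
        simp only [h1]
        rw [← Finset.mul_sum, hsum]
        ring)
    rw [Fintype.sum_option] at this
    simp only [Option.elim] at this
    rw [hΦ ⟨P, hP⟩]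
    rw [neg_smul, one_smul, neg_add_eq_zero] at this
    exact this.symm
  refine ⟨Φ, hpt, ?_⟩
  intro P hP hPA hl
  obtain ⟨u, huΛ, hu0, huP, huA⟩ : ∃ u ∈ Λ, u ≠ 0 ∧ (fun x => x + u) '' P = P ∧
      u ∈ A.direction := by
    obtain ⟨n, φ, c, hintg, rfl⟩ := ratPoly_exists hΛ hP
    obtain ⟨x, u, hu, hline⟩ := hl
    obtain ⟨u', hu', hne, hz⟩ := exists_lattice_solution hΛ φ hintg hu
      (hpoly_line_iff φ c hline)
    refine ⟨u', hu', hne, ?_, ?_⟩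
    · ext y
      constructor
      · rintro ⟨y, hy, rfl⟩ i
        rw [pairE_add, hz, add_zero]
        exact hy i
      · intro hy
        refine ⟨y - u', fun i => ?_, by simp⟩
        rw [pairE_sub, hz, sub_zero]
        exact hy i
    · have h1 : x ∈ A := hPA (by simpa using hline 0)
      have h2 : x + u' ∈ A := by
        apply hPA
        intro i
        rw [pairE_add, hz, add_zero]
        have := hline 0 i
        simpa using this
      have := A.vsub_mem_direction h2 h1
      simpa using this
  set E := toG (fun ξ : Vd d => Real.exp (pairE ξ u)) with hE
  have h1 : ind P = ∑ σ, s σ • ind (P ∩ O σ) := by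
    ext x
    simp only [Finset.sum_apply, Pi.smul_apply, smul_eq_mul, ind_inter]
    have h1 : ∀ σ, s σ * (ind P x * ind (O σ) x) = ind P x * (s σ * ind (O σ) x) :=
      fun σ => by ring
    simp only [h1]
    rw [← Finset.mul_sum, hsum, mul_one]
  have h2 : ind P = ∑ σ, s σ • ind ((fun x => x + u) '' (P ∩ O σ)) := by
    ext x
    simp only [Finset.sum_apply, Pi.smul_apply, smul_eq_mul, ind_image]
    conv_lhs => rw [← huP, ind_image, h1]
    simp
  have h3 : Φ (ind P) = E * Φ (ind P) := by
    conv_lhs => rw [h2]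
    conv_rhs => rw [h1]
    rw [map_sum, map_sum, Finset.mul_sum]
    refine Finset.sum_congr rfl fun σ _ => ?_
    rw [map_smul, map_smul, hpt _ (hPO P hP σ) (hPOl P σ), germ_mul_smul,
      ← hT.translate hΛ (hPO P hP σ) (hPOl P σ) huΛ huA, hpt]
    · exact ratPoly_translate hΛ (hPO P hP σ) huΛ
    · rintro ⟨x, v, hv, hline⟩
      refine hPOl P σ ⟨x - u, v, hv, fun t => ?_⟩
      obtain ⟨y, hy, hyx⟩ := hline t
      have : x - u + t • v = y := by
        rw [← add_sub_cancel_right y u]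
        rw [show y + u = x + t • v from hyx]
        abel
      rwa [this]
  revert h3
  generalize Φ (ind P) = g
  induction g using Germ.inductionOn with
  | _ f =>
  intro h3
  have h4 : f =ᶠ[meroFilter d] fun ξ => Real.exp (pairE ξ u) * f ξ := Germ.coe_eq.1 h3
  refine Germ.coe_eq.2 ?_
  filter_upwards [h4, exp_ne_one_eventually hu0] with ξ h5 h6
  have : (Real.exp (pairE ξ u) - 1) * f ξ = 0 := by linarith
  exact (mul_eq_zero.1 this).resolve_left h6

/-- passing to the tangent cone at `w` is linear on indicator functions. -/
theorem exists_tangent_linear {Λ : AddSubgroup (Vd d)} (hΛ : IsFullLattice Λ) (w : Vd d) :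
    ∃ Ψ : (Vd d → ℝ) →ₗ[ℝ] (Vd d → ℝ),
      ∀ P, IsRatPolyhedron Λ P → Ψ (ind P) = ind (tanC P w) := by
  classical
  obtain ⟨Ψ, hΨ⟩ := exists_linear_of_relations
    (fun P : {P : Set (Vd d) // IsRatPolyhedron Λ P} => ind P.1)
    (fun P => ind (tanC P.1 w)) (by
      intro J c hrel
      ext z
      have h1 : ∀ᶠ t in 𝓝[>] (0 : ℝ), ∀ P ∈ J, (w + t • (z - w) ∈ P.1 ↔ z ∈ tanC P.1 w) :=
        (Filter.eventually_all_finset J).2 fun P _ => tanC_eventually hΛ P.2 w z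
      obtain ⟨t, ht⟩ := h1.exists
      have h2 := congrFun hrel (w + t • (z - w))
      rw [Pi.zero_apply] at h2 ⊢
      rw [← h2]
      simp only [Finset.sum_apply, Pi.smul_apply, smul_eq_mul]
      refine Finset.sum_congr rfl fun P hP => ?_
      rw [ind_apply, ind_apply]
      simp only [ht P hP])
  exact ⟨Ψ, fun P hP => hΨ ⟨P, hP⟩⟩

/-- the set cut out in `A` by the inequalities indexed by `K`. -/
def cutA (A : AffineSubspace ℝ (Vd d)) {ι : Type*} (φ : ι → Vd d) (c : ι → ℚ) (K : Finset ι) :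
    Set (Vd d) := {x | x ∈ A ∧ ∀ i ∈ K, pairE (φ i) x ≤ c i}

theorem fredholm (A : AffineSubspace ℝ (Vd d)) {x0 : Vd d} (hx0 : x0 ∈ A) {ι : Type*}
    [Fintype ι] (φ : ι → Vd d) (c : ι → ℚ) (K : Finset ι)
    (hK : ¬ ∃ v ∈ A, ∀ i ∈ K, pairE (φ i) v = c i) :
    ∃ a : ι → ℝ, ∀ x ∈ A, ∑ i ∈ K, a i * (pairE (φ i) x - c i) < 0 := by
  classical
  let M : Vd d →ₗ[ℝ] (ι → ℝ) := LinearMap.pi fun i => if i ∈ K then pairL (φ i) else 0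
  have hM : ∀ u i, M u i = if i ∈ K then pairE (φ i) u else 0 := by
    intro u i
    simp only [M, LinearMap.pi_apply]
    split_ifs <;> rfl
  let t : ι → ℝ := fun i => if i ∈ K then c i - pairE (φ i) x0 else 0
  have ht : t ∉ A.direction.map M := by
    rintro ⟨u, hu, hut⟩
    refine hK ⟨u + x0, ?_, ?_⟩
    · exact AffineSubspace.vadd_mem_of_mem_direction hu hx0
    · intro i hi
      have := congrFun hut i
      rw [hM] at this
      simp only [t, hi, if_true] at this
      rw [pairE_add, this]
      ring
  obtain ⟨f, hf1, hf2⟩ := Submodule.exists_le_ker_of_notMem ht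
  have main : ∀ g : (ι → ℝ) →ₗ[ℝ] ℝ, 0 < g t → A.direction.map M ≤ LinearMap.ker g →
      ∃ a : ι → ℝ, ∀ x ∈ A, ∑ i ∈ K, a i * (pairE (φ i) x - c i) < 0 := by
    intro g hg1 hg2
    refine ⟨fun i => g (Pi.single i 1), fun x hx => ?_⟩
    have hg : ∀ y : ι → ℝ, (∀ i, i ∉ K → y i = 0) → g y = ∑ i ∈ K, g (Pi.single i 1) * y i := by
      intro y hy
      have h1 : y = ∑ i ∈ K, y i • (Pi.single i 1 : ι → ℝ) := by
        ext j
        rw [Finset.sum_apply]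
        simp only [Pi.smul_apply, Pi.single_apply, smul_eq_mul, mul_ite, mul_one, mul_zero]
        rw [Finset.sum_ite_eq]
        split_ifs with h
        · rfl
        · exact hy j h
      conv_lhs => rw [h1]
      rw [map_sum]
      refine Finset.sum_congr rfl fun i _ => ?_
      rw [map_smul, smul_eq_mul, mul_comm]
    have h2 : g (M (x - x0)) = 0 := hg2 ⟨x - x0, A.vsub_mem_direction hx hx0, rfl⟩
    have h3 : g (M (x - x0) - t) < 0 := by
      rw [map_sub, h2]; linarith
    rw [hg] at h3
    · refine lt_of_eq_of_lt (Finset.sum_congr rfl fun i hi => ?_) h3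
      rw [Pi.sub_apply, hM]
      simp only [t, hi, if_true, pairE_sub]
      ring
    · intro i hi
      rw [Pi.sub_apply, hM]
      simp [t, hi]
  rcases lt_or_gt_of_ne hf1 with h | h
  · exact main (-f) (by simpa using h) fun y hy => by
      rw [LinearMap.mem_ker, LinearMap.neg_apply, LinearMap.mem_ker.1 (hf2 hy), neg_zero]
  · exact main f h hf2

/-- the indicator function of a polyhedron is a linear combination of indicator functions of
cones cut out by subsystems of its inequalities. -/
theorem cone_decomposition (A : AffineSubspace ℝ (Vd d)) {x0 : Vd d} (hx0 : x0 ∈ A) {ι : Type*}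
    [Fintype ι] (φ : ι → Vd d) (c : ι → ℚ) (K : Finset ι) :
    ind (cutA A φ c K) ∈ Submodule.span ℝ {f | ∃ K' : Finset ι,
      (∃ v ∈ A, ∀ i ∈ K', pairE (φ i) v = c i) ∧ f = ind (cutA A φ c K')} := by
  classical
  induction K using Finset.strongInduction with
  | H K ih =>
  by_cases hK : ∃ v ∈ A, ∀ i ∈ K, pairE (φ i) v = c i
  · exact Submodule.subset_span ⟨K, hK, rfl⟩
  obtain ⟨a, ha⟩ := fredholm A hx0 φ c K hK
  set Q := K.filter fun i => 0 < a i with hQ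
  set R := K.filter fun i => ¬ 0 < a i with hR
  let h : ι → Vd d → ℝ := fun i x => if pairE (φ i) x ≤ c i then 1 else 0
  have hcut : ∀ (S : Finset ι), S ⊆ Q → ∀ x,
      ind (cutA A φ c (S ∪ R)) x = (ind (A : Set (Vd d)) x * ∏ i ∈ R, h i x) * ∏ i ∈ S, h i x := by
    intro S hS x
    have hdisj : Disjoint S R := by
      rw [Finset.disjoint_left]
      intro i hi hi'
      exact (Finset.mem_filter.1 hi').2 (Finset.mem_filter.1 (hS hi)).2
    rw [mul_assoc, mul_comm (∏ i ∈ R, h i x), ← Finset.prod_union hdisj]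
    simp only [h, Finset.prod_ite_zero, Finset.prod_const_one, ind_apply, cutA,
      Set.mem_ofPred_eq, SetLike.mem_coe]
    split_ifs <;> simp_all
  have hrel : ∑ S ∈ Q.powerset, (-1 : ℝ) ^ S.card • ind (cutA A φ c (S ∪ R)) = 0 := by
    ext x
    simp only [Finset.sum_apply, Pi.smul_apply, smul_eq_mul, Pi.zero_apply]
    have h1 : ∀ S ∈ Q.powerset, (-1 : ℝ) ^ S.card * ind (cutA A φ c (S ∪ R)) x =
        (ind (A : Set (Vd d)) x * ∏ i ∈ R, h i x) *
          ((∏ i ∈ S, (- h i x)) * ∏ i ∈ Q \ S, (1 : ℝ)) := by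
      intro S hS
      rw [hcut S (Finset.mem_powerset.1 hS), Finset.prod_neg, Finset.prod_const_one]
      ring
    rw [Finset.sum_congr rfl h1, ← Finset.mul_sum, ← Finset.prod_add]
    by_cases hxA : x ∈ A
    · by_cases hxR : ∀ i ∈ R, pairE (φ i) x ≤ c i
      · have : ∃ i ∈ Q, pairE (φ i) x ≤ c i := by
          by_contra hcon
          push Not at hcon
          refine absurd (ha x hxA) (not_lt.2 (Finset.sum_nonneg fun i hi => ?_))
          by_cases hai : 0 < a i
          · have := hcon i (Finset.mem_filter.2 ⟨hi, hai⟩)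
            exact mul_nonneg hai.le (by linarith)
          · have := hxR i (Finset.mem_filter.2 ⟨hi, hai⟩)
            exact mul_nonneg_of_nonpos_of_nonpos (not_lt.1 hai) (by linarith)
        obtain ⟨i, hi, hix⟩ := this
        rw [Finset.prod_eq_zero (s := Q) hi, mul_zero]
        simp [h, hix]
      · push Not at hxR
        obtain ⟨i, hi, hix⟩ := hxR
        rw [Finset.prod_eq_zero (s := R) hi]
        · simp
        · simp [h, not_le.2 hix]
    · rw [ind_apply, if_neg (by simpa using hxA)]
      simp
  have hQK : Q ∪ R = K := Finset.filter_union_filter_not_eq _ _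
  rw [← Finset.add_sum_erase _ _ (Finset.mem_powerset_self Q), hQK] at hrel
  have h2 : (-1 : ℝ) ^ Q.card • ind (cutA A φ c K) ∈ Submodule.span ℝ {f | ∃ K' : Finset ι,
      (∃ v ∈ A, ∀ i ∈ K', pairE (φ i) v = c i) ∧ f = ind (cutA A φ c K')} := by
    rw [eq_neg_of_add_eq_zero_left hrel]
    refine Submodule.neg_mem _ (Submodule.sum_mem _ fun S hS => Submodule.smul_mem _ _ ?_)
    rw [Finset.mem_erase, Finset.mem_powerset] at hS
    apply ih
    rw [← hQK]
    refine ⟨Finset.union_subset_union_left hS.2, fun hsub => hS.1 (hS.2.antisymm fun i hi => ?_)⟩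
    rcases Finset.mem_union.1 (hsub (Finset.mem_union_left _ hi)) with h | h
    · exact h
    · exact absurd (Finset.mem_filter.1 hi).2 (Finset.mem_filter.1 h).2
  rwa [Submodule.smul_mem_iff _ (pow_ne_zero _ (by norm_num))] at h2

theorem tanC_subset_affine {A : AffineSubspace ℝ (Vd d)} {P : Set (Vd d)} (hPA : P ⊆ A)
    (w : Vd d) : tanC P w ⊆ A := by
  rintro z ⟨hw, ε, hε, h⟩
  have h1 : w + ε • (z - w) ∈ A := hPA (h ε hε le_rfl)
  have h2 := AffineMap.lineMap_mem (Q := A) ε⁻¹ (hPA hw) h1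
  rw [AffineMap.lineMap_apply] at h2
  have h3 : ε⁻¹ • (w + ε • (z - w) -ᵥ w) +ᵥ w = z := by
    rw [vsub_eq_sub, vadd_eq_add, add_sub_cancel_left, smul_smul, inv_mul_cancel₀ hε.ne',
      one_smul, sub_add_cancel]
  rwa [h3] at h2

/-- for a cone with apex `v`, all the tangent cones except the one at `v` are degenerate. -/
theorem cone_tanC {C : Set (Vd d)} (hC : Convex ℝ C) {v : Vd d} (hv : v ∈ C)
    (hcone : ∀ x ∈ C, ∀ t : ℝ, 0 ≤ t → v + t • (x - v) ∈ C) :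
    tanC C v = C ∧ ∀ w ∈ C, w ≠ v → ContainsLine (tanC C w) := by
  constructor
  · apply Set.Subset.antisymm
    · rintro z ⟨-, ε, hε, h⟩
      have h1 := hcone _ (h ε hε le_rfl) ε⁻¹ (inv_nonneg.2 hε.le)
      rwa [add_sub_cancel_left, smul_smul, inv_mul_cancel₀ hε.ne', one_smul,
        add_sub_cancel] at h1
    · exact subset_tanC hC hv
  · intro w hw hne
    refine tanC_line hC (sub_ne_zero.2 hne) ?_ ?_
    · have := hcone w hw 2 (by norm_num)
      rw [two_smul] at this
      convert this using 1
      abel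
    · rwa [sub_sub_cancel]

/-- Brion's theorem for an exponential valuation. -/
theorem ValData.brion {Λ : AddSubgroup (Vd d)} (hΛ : IsFullLattice Λ)
    {A : AffineSubspace ℝ (Vd d)} (hA : IsRatPolyhedron Λ (A : Set (Vd d)))
    {ν : Measure (Vd d)} {T : Set (Vd d) → Vd d → ℝ} (hT : ValData Λ A ν T)
    {P : Set (Vd d)} (hP : IsRatPolyhedron Λ P) (hPA : P ⊆ A) (hl : ¬ ContainsLine P)
    (hne : P.Nonempty)
    (W : Finset (Vd d)) (hW : ∀ w, w ∈ W ↔ w ∈ P ∧ ¬ ContainsLine (tanC P w)) :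
    toG (T P) = ∑ w ∈ W, toG (T (tanC P w)) := by
  classical
  obtain ⟨x0, hx0⟩ := hne
  obtain ⟨Φ, hΦ1, hΦ2⟩ := hT.exists_linear hΛ
  choose Ψ hΨ using fun w => exists_tangent_linear hΛ w
  have hzero : Φ (ind ∅) = 0 := by
    have : ind (∅ : Set (Vd d)) = 0 := by ext x; simp [ind]
    rw [this, map_zero]
  have hdeg : ∀ C, IsRatPolyhedron Λ C → C ⊆ A → ∀ w, (w ∈ C → ContainsLine (tanC C w)) →
      Φ (Ψ w (ind C)) = 0 := by
    intro C hC hCA w hw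
    rw [hΨ w C hC]
    by_cases h : w ∈ C
    · exact hΦ2 _ (ratPoly_tanC hΛ hC w) (tanC_subset_affine hCA w) (hw h)
    · rw [tanC_empty h, hzero]
  obtain ⟨n, φ, c, hintg, hPeq⟩ := ratPoly_exists hΛ hP
  have hcutP : P = cutA A φ c Finset.univ := by
    ext x
    constructor
    · intro hx
      exact ⟨hPA hx, fun i _ => by rw [hPeq] at hx; exact hx i⟩
    · rintro ⟨-, h⟩
      rw [hPeq]
      exact fun i => h i (Finset.mem_univ i)
  have hcut : ∀ K, IsRatPolyhedron Λ (cutA A φ c K) := by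
    intro K
    have : cutA A φ c K = (A : Set (Vd d)) ∩
        hpoly (fun i : {i // i ∈ K} => φ i) (fun i => c i) := by
      ext x
      simp [cutA, hpoly]
    rw [this]
    exact ratPoly_inter hΛ hA (ratPoly_of hΛ _ _ fun i => hintg i)
  let ap : Finset (Fin n) → Vd d := fun K =>
    if h : ∃ v ∈ A, ∀ i ∈ K, pairE (φ i) v = c i then h.choose else 0
  have hap : ∀ K, (∃ v ∈ A, ∀ i ∈ K, pairE (φ i) v = c i) →
      ap K ∈ A ∧ ∀ i ∈ K, pairE (φ i) (ap K) = c i := by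
    intro K h
    simp only [ap, dif_pos h]
    exact h.choose_spec
  set W' : Finset (Vd d) := W ∪ Finset.univ.image ap with hW'
  let Θ : (Vd d → ℝ) →ₗ[ℝ] MGerm d := Φ - ∑ w ∈ W', Φ ∘ₗ Ψ w
  have hΘ : ∀ f, Θ f = Φ f - ∑ w ∈ W', Φ (Ψ w f) := by
    intro f
    simp [Θ]
  have hker : Submodule.span ℝ {f | ∃ K' : Finset (Fin n),
      (∃ v ∈ A, ∀ i ∈ K', pairE (φ i) v = c i) ∧ f = ind (cutA A φ c K')} ≤
      LinearMap.ker Θ := by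
    rw [Submodule.span_le]
    rintro f ⟨K, hK, rfl⟩
    obtain ⟨hvA, hv⟩ := hap K hK
    rw [SetLike.mem_coe, LinearMap.mem_ker, hΘ, sub_eq_zero]
    have hCA : cutA A φ c K ⊆ A := fun x hx => hx.1
    have hCc := ratPoly_convex hΛ (hcut K)
    have hvC : ap K ∈ cutA A φ c K := ⟨hvA, fun i hi => (hv i hi).le⟩
    have hcone : ∀ x ∈ cutA A φ c K, ∀ t : ℝ, 0 ≤ t → ap K + t • (x - ap K) ∈ cutA A φ c K := by
      intro x hx t ht
      refine ⟨?_, fun i hi => ?_⟩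
      · have := AffineMap.lineMap_mem (Q := A) t hvA hx.1
        rw [AffineMap.lineMap_apply, vsub_eq_sub, vadd_eq_add] at this
        rwa [add_comm]
      · rw [pairE_add, pairE_smul, pairE_sub, hv i hi]
        have := hx.2 i hi
        nlinarith
    obtain ⟨h1, h2⟩ := cone_tanC hCc hvC hcone
    rw [Finset.sum_eq_single (ap K)]
    · rw [hΨ _ _ (hcut K), h1]
    · intro w _ hw
      exact hdeg _ (hcut K) hCA w fun hwC => h2 w hwC hw
    · intro h
      exact absurd (Finset.mem_union_right _ (Finset.mem_image_of_mem _ (Finset.mem_univ K))) h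
  have h1 : Θ (ind P) = 0 := by
    rw [hcutP]
    exact hker (cone_decomposition A (hPA hx0) φ c Finset.univ)
  rw [hΘ, sub_eq_zero, hΦ1 P hP hl] at h1
  rw [h1]
  have hsub : W ⊆ W' := Finset.subset_union_left
  rw [← Finset.sum_subset hsub]
  · refine Finset.sum_congr rfl fun w hw => ?_
    rw [hΨ w P hP, hΦ1 _ (ratPoly_tanC hΛ hP w) ((hW w).1 hw).2]
  · intro w _ hw
    refine hdeg P hP hPA w fun hwP => ?_
    by_contra hcon
    exact hw ((hW w).2 ⟨hwP, hcon⟩)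

/-- a rational polyhedron has finitely many vertices. -/
theorem vertices_finite {Λ : AddSubgroup (Vd d)} (hΛ : IsFullLattice Λ)
    {P : Set (Vd d)} (hP : IsRatPolyhedron Λ P) :
    {w | w ∈ P ∧ ¬ ContainsLine (tanC P w)}.Finite := by
  classical
  obtain ⟨n, φ, c, hintg, rfl⟩ := ratPoly_exists hΛ hP
  refine Set.Finite.of_finite_image (f := fun w => Finset.univ.filter
    fun i => pairE (φ i) w = c i) (Set.toFinite _) ?_
  rintro w ⟨hw, hl⟩ w' ⟨hw', hl'⟩ heq
  beta_reduce at heq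
  by_contra hne
  apply hl
  rw [tanC_hpoly _ _ hw]
  refine ⟨w, w' - w, sub_ne_zero.2 (Ne.symm hne), fun t i hi => ?_⟩
  have : i ∈ Finset.univ.filter fun i => pairE (φ i) w' = c i := by
    rw [← heq]
    simp [hi]
  rw [pairE_add, pairE_smul, pairE_sub, hi, (Finset.mem_filter.1 this).2]
  simp

end Brion

section Instances

variable {d : ℕ}

theorem lattice_discrete {Λ : AddSubgroup (Vd d)} (hΛ : IsFullLattice Λ) :
    DiscreteTopology Λ.toIntSubmodule := by
  obtain ⟨k, b, hb, hintg⟩ := lattice_basis hΛ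
  have hsub : (Λ.toIntSubmodule : Set (Vd d)) ⊆ (Submodule.span ℤ (Set.range b) : Set (Vd d)) := by
    intro x hx
    rw [SetLike.mem_coe, Module.Basis.mem_span_iff_repr_mem]
    intro i
    obtain ⟨n, hn⟩ := hintg x hx i
    exact ⟨n, by rw [hn]; simp⟩
  have hd : DiscreteTopology (Submodule.span ℤ (Set.range b)) := inferInstance
  exact DiscreteTopology.of_subset (s := (Submodule.span ℤ (Set.range b) : Set (Vd d))) hd hsub

theorem lattice_countable {Λ : AddSubgroup (Vd d)} (hΛ : IsFullLattice Λ) : Countable Λ := by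
  obtain ⟨k, b, hb, hintg⟩ := lattice_basis hΛ
  choose n hn using fun x : Λ => hintg x.1 x.2
  refine Function.Injective.countable (f := n) fun x y hxy => Subtype.ext (b.ext_elem fun i => ?_)
  rw [hn, hn, hxy]

theorem summable_lattice {Λ : AddSubgroup (Vd d)} (hΛ : IsFullLattice Λ) :
    ∃ r : ℕ, Summable (fun x : Λ => ((1 + ‖(x : Vd d)‖) ^ r)⁻¹) := by
  classical
  have := lattice_discrete hΛ
  refine ⟨Module.finrank ℤ Λ.toIntSubmodule + 1, ?_⟩
  have h1 := ZLattice.summable_norm_pow_inv Λ.toIntSubmodule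
    (Module.finrank ℤ Λ.toIntSubmodule + 1) (Nat.lt_succ_self _)
  have h2 : Summable fun z : Λ.toIntSubmodule => if z = 0 then (1 : ℝ) else 0 :=
    (hasSum_ite_eq 0 1).summable
  refine Summable.of_nonneg_of_le (fun x => by positivity) (fun x => ?_) (h1.add h2)
  change ((1 + ‖(x : Vd d)‖) ^ _)⁻¹ ≤ ‖(x : Vd d)‖⁻¹ ^ _ + (if x = 0 then (1 : ℝ) else 0)
  split_ifs with h
  · subst h
    simp
  · have hx : 0 < ‖(x : Vd d)‖ := norm_pos_iff.2 fun h' => h (Subtype.ext h')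
    rw [add_zero, inv_pow]
    gcongr
    linarith

/-- the counting measure of the lattice. -/
noncomputable def latMeas (Λ : AddSubgroup (Vd d)) : Measure (Vd d) :=
  Measure.map (Subtype.val : Λ → Vd d) Measure.count

/-- the discrete generating function is a valuation. -/
theorem valData_S {Λ : AddSubgroup (Vd d)} (hΛ : IsFullLattice Λ) {S : Set (Vd d) → Vd d → ℝ}
    (hS : IsSMap Λ S) : ValData Λ ⊤ (latMeas Λ) S := by
  classical
  have hcount := lattice_countable hΛ
  have hmeas : MeasurableSet (Λ : Set (Vd d)) := (Set.countable_coe_iff.1 hcount).measurableSet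
  have hemb : MeasurableEmbedding (Subtype.val : Λ → Vd d) := MeasurableEmbedding.subtype_coe hmeas
  refine ⟨fun P hP => (hS.1 P hP).mer, ?_, ?_, ?_⟩
  · intro P hP ξ hintg
    set f : Vd d → ℝ := fun x => Real.exp (pairE ξ x) with hf
    have hPm := (ratPoly_closed hΛ hP).measurableSet
    have hPm' : MeasurableSet ((Subtype.val : Λ → Vd d) ⁻¹' P) := measurable_subtype_coe hPm
    let e : ↥((Subtype.val : Λ → Vd d) ⁻¹' P) ≃ ↥(P ∩ (Λ : Set (Vd d))) :=
      { toFun := fun x => ⟨x.1.1, x.2, x.1.2⟩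
        invFun := fun x => ⟨⟨x.1, x.2.2⟩, x.2.1⟩
        left_inv := fun x => rfl
        right_inv := fun x => rfl }
    unfold latMeas at hintg ⊢
    rw [hemb.integrableOn_map_iff, ← integrable_indicator_iff hPm', integrable_count_iff] at hintg
    have hsum : Summable (((Subtype.val : Λ → Vd d) ⁻¹' P).indicator (f ∘ Subtype.val)) :=
      hintg.of_norm
    have hsum2 : Summable ((f ∘ Subtype.val) ∘
      (Subtype.val : ↥((Subtype.val : Λ → Vd d) ⁻¹' P) → Λ)) := summable_subtype_iff_indicator.2 hsum
    have hsum3 : Summable (fun x : ↥(P ∩ (Λ : Set (Vd d))) => f x) := by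
      rw [← e.summable_iff]
      exact hsum2
    rw [hS.2.2 P hP ξ hsum3, hemb.setIntegral_map, ← integral_indicator hPm',
      ← e.tsum_eq]
    refine Eq.trans ?_ (integral_countable (integrable_count_iff.2 hintg)).symm
    simp only [count_real_singleton, one_smul]
    exact tsum_subtype ((Subtype.val : Λ → Vd d) ⁻¹' P) (f ∘ Subtype.val)
  · obtain ⟨r, hr⟩ := summable_lattice hΛ
    refine ⟨r, ?_⟩
    unfold latMeas
    rw [hemb.integrable_map_iff, integrable_count_iff]
    exact hr.norm
  · intro u hu _
    refine ⟨measurable_add_const u, ?_⟩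
    unfold latMeas
    have h1 : Measure.map (fun x : Λ => x + ⟨u, hu⟩) Measure.count = Measure.count :=
      (measurePreserving_add_right Measure.count (⟨u, hu⟩ : Λ)).map_eq
    rw [Measure.map_map (measurable_add_const u) measurable_subtype_coe]
    conv_rhs => rw [← h1]
    rw [Measure.map_map measurable_subtype_coe (measurable_of_countable _)]
    rfl

/-- existence of the canonical measure of a rational affine subspace. -/
theorem exists_canonical {Λ : AddSubgroup (Vd d)} (hΛ : IsFullLattice Λ) {ι : Type*}
    (φ : ι → Vd d) (hφ : ∀ i, IsDualIntegral Λ (φ i)) (c : ι → ℝ) {x₀ : Vd d}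
    (hx₀ : ∀ i, pairE (φ i) x₀ = c i) :
    ∃ m, IsCanonicalMeasure Λ {x | ∀ i, pairE (φ i) x = c i} m := by
  classical
  have hdisc := lattice_discrete hΛ
  let N : Submodule ℤ (Vd d) := Λ.toIntSubmodule ⊓
    ((⨅ i, LinearMap.ker (pairL (φ i)) : Submodule ℝ (Vd d)).restrictScalars ℤ)
  have hN : ∀ x, x ∈ N ↔ x ∈ Λ ∧ ∀ i, pairE (φ i) x = 0 := by
    intro x
    simp only [N, Submodule.mem_inf, Submodule.restrictScalars_mem, Submodule.mem_iInf,
      LinearMap.mem_ker, pairL_apply]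
    exact Iff.rfl
  have hNd : DiscreteTopology N := by
    have hsub : (N : Set (Vd d)) ⊆ (Λ.toIntSubmodule : Set (Vd d)) := fun x hx => hx.1
    exact DiscreteTopology.of_subset (s := (Λ.toIntSubmodule : Set (Vd d))) hdisc hsub
  let b := Module.finBasis ℤ N
  set k := Module.finrank ℤ N
  let v : Fin k → Vd d := fun i => (b i : Vd d)
  have hspan : Submodule.span ℤ (Set.range v) = N := by
    have : Set.range v = N.subtype '' Set.range b := by
      rw [← Set.range_comp]; rfl
    rw [this, Submodule.span_image, b.span_eq, Submodule.map_top, Submodule.range_subtype]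
  have hli : LinearIndependent ℝ v := by
    rw [linearIndependent_iff_card_eq_finrank_span,
      Real.finrank_eq_int_finrank_of_discrete (by rw [hspan]; exact hNd)]
    unfold Set.finrank
    rw [hspan, Fintype.card_fin]
  have hvN : ∀ i, v i ∈ Λ ∧ ∀ j, pairE (φ j) (v i) = 0 := fun i => (hN _).1 (b i).2
  have hcoef : ∀ y ∈ N, ∃ c : Fin k → ℤ, y = ∑ i, (c i : ℝ) • v i := by
    intro y hy
    refine ⟨fun i => b.repr ⟨y, hy⟩ i, ?_⟩
    have := congrArg (N.subtype) (b.sum_repr ⟨y, hy⟩)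
    rw [map_sum] at this
    have h2 : y = N.subtype ⟨y, hy⟩ := rfl
    refine h2.trans (this.symm.trans ?_)
    refine Finset.sum_congr rfl fun i _ => ?_
    rw [map_smul, Int.cast_smul_eq_zsmul]
    rfl
  refine ⟨_, k, x₀, v, hx₀, fun i => (hvN i).1, hli, ?_, ?_, rfl⟩
  · ext x
    constructor
    · intro hx
      have h1 : x - x₀ ∈ Submodule.span ℝ {x | x ∈ Λ ∧ ∀ i, pairE (φ i) x = 0} :=
        span_solutions hΛ φ hφ fun i => by rw [pairE_sub, hx i, hx₀ i, sub_self]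
      have h2 : Submodule.span ℝ {x | x ∈ Λ ∧ ∀ i, pairE (φ i) x = 0} ≤
          Submodule.span ℝ (Set.range v) := by
        rw [Submodule.span_le]
        intro y hy
        obtain ⟨c, rfl⟩ := hcoef y ((hN y).2 hy)
        exact Submodule.sum_mem _ fun i _ => Submodule.smul_mem _ _
          (Submodule.subset_span ⟨i, rfl⟩)
      obtain ⟨t, ht⟩ := (Submodule.mem_span_range_iff_exists_fun ℝ).1 (h2 h1)
      exact ⟨t, by rw [ht]; abel⟩
    · rintro ⟨t, rfl⟩ i
      rw [pairE_add, pairE_sum, hx₀, Finset.sum_eq_zero, add_zero]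
      intro j _
      rw [pairE_smul, (hvN j).2, mul_zero]
  · intro y hy hys
    apply hcoef
    rw [hN]
    refine ⟨hy, fun i => ?_⟩
    obtain ⟨t, rfl⟩ := (Submodule.mem_span_range_iff_exists_fun ℝ).1 hys
    rw [pairE_sum, Finset.sum_eq_zero]
    intro j _
    rw [pairE_smul, (hvN j).2, mul_zero]

open Classical in
/-- the continuous generating function, restricted to full-dimensional pieces of `A`. -/
noncomputable def TI (I : Set (Vd d) → Vd d → ℝ) (A : AffineSubspace ℝ (Vd d))
    (P : Set (Vd d)) : Vd d → ℝ :=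
  if affineSpan ℝ (P ∩ A) = A then I (P ∩ A) else fun _ => 0

/-- the continuous generating function is a valuation. -/
theorem valData_I {Λ : AddSubgroup (Vd d)} (hΛ : IsFullLattice Λ) {I : Set (Vd d) → Vd d → ℝ}
    (hI : IsIMap Λ I) {A : AffineSubspace ℝ (Vd d)} (hA : IsRatPolyhedron Λ (A : Set (Vd d)))
    {m : Measure (Vd d)} (hm : IsCanonicalMeasure Λ (A : Set (Vd d)) m) :
    ValData Λ A m (TI I A) := by
  classical
  obtain ⟨k, x₀, v, hx₀, hvΛ, hli, hAeq, hcoef, hmeq⟩ := id hm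
  let L : (Fin k → ℝ) →ₗ[ℝ] Vd d := Fintype.linearCombination ℝ v
  have hL : ∀ t, L t = ∑ i, t i • v i := fun t => Fintype.linearCombination_apply ℝ v t
  have hLinj : LinearMap.ker L = ⊥ := by
    rw [LinearMap.ker_eq_bot]
    exact hli.fintypeLinearCombination_injective
  let g : (Fin k → ℝ) →ᵃ[ℝ] Vd d := L.toAffineMap + AffineMap.const ℝ _ x₀
  have hg : ∀ t, g t = x₀ + L t := by
    intro t
    simp [g, add_comm]
  have hgm : m = Measure.map g volume := by
    rw [hmeq]
    congr 1
    ext1 t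
    rw [hg, hL]
  have hgA : ∀ t, g t ∈ A := by
    intro t
    have : g t ∈ (A : Set (Vd d)) := by
      rw [hAeq]
      exact ⟨t, by rw [hg, hL]⟩
    exact this
  have hgc : IsClosedEmbedding g := by
    have h1 : IsClosedEmbedding L := L.isClosedEmbedding_of_injective hLinj
    have h2 : (g : (Fin k → ℝ) → Vd d) = (fun x => x₀ + x) ∘ L := funext hg
    rw [h2]
    exact (Homeomorph.addLeft x₀).isClosedEmbedding.comp h1
  have hemb : MeasurableEmbedding g := hgc.measurableEmbedding
  have hPA : ∀ P, IsRatPolyhedron Λ P → IsRatPolyhedron Λ (P ∩ A) :=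
    fun P hP => ratPoly_inter hΛ hP hA
  have hrestr : ∀ P, m.restrict P = m.restrict (P ∩ A) := by
    intro P
    rw [hgm, hemb.restrict_map, hemb.restrict_map]
    congr 2
    ext t
    simp [hgA t]
  refine ⟨?_, ?_, ?_, ?_⟩
  · intro P hP
    unfold TI
    split_ifs
    · exact (hI.1 _ (hPA P hP)).mer
    · exact Mer.of_analytic analyticAt_const
  · intro P hP ξ hintg
    unfold TI
    split_ifs with h
    · rw [hrestr P]
      refine hI.2.2 _ (hPA P hP) m ?_ ξ ?_
      · rw [h]; exact hm
      · unfold IntegrableOn at hintg ⊢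
        rwa [← hrestr P]
    · rw [hrestr P]
      have hz : m (P ∩ A) = 0 := by
        rw [hgm, hemb.map_apply]
        refine measure_mono_null (t := ((affineSpan ℝ (P ∩ A)).comap g : Set (Fin k → ℝ))) ?_ ?_
        · intro t ht
          exact subset_affineSpan ℝ _ ht
        · apply Measure.addHaar_affineSubspace
          intro htop
          apply h
          apply le_antisymm
          · rw [affineSpan_le]
            exact Set.inter_subset_right
          · intro x hx
            have hx' : x ∈ (A : Set (Vd d)) := hx
            rw [hAeq] at hx'
            obtain ⟨t, rfl⟩ := hx'
            have ht : t ∈ (affineSpan ℝ (P ∩ A)).comap g := by rw [htop]; trivial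
            rw [AffineSubspace.mem_comap, hg, hL] at ht
            exact ht
      rw [Measure.restrict_eq_zero.2 hz, integral_zero_measure]
  · refine ⟨k + 1, ?_⟩
    rw [hgm, hemb.integrable_map_iff]
    obtain ⟨K, hK, hanti⟩ := L.exists_antilipschitzWith hLinj
    have h1 : Integrable (fun t : Fin k → ℝ => (1 + ‖t‖) ^ (-((k + 1 : ℕ) : ℝ))) volume := by
      apply integrable_one_add_norm
      simp
    set C : ℝ := 1 + K + K * ‖x₀‖ with hC
    have hCpos : 0 < C := by positivity
    refine (h1.const_mul (C ^ (k + 1))).mono' ?_ ?_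
    · refine (Continuous.inv₀ ?_ ?_).aestronglyMeasurable
      · exact (continuous_const.add hgc.continuous.norm).pow _
      · intro t
        positivity
    · refine Filter.Eventually.of_forall fun t => ?_
      have h2 : ‖t‖ ≤ K * ‖L t‖ := by
        have := hanti.le_mul_dist t 0
        rwa [dist_zero_right, map_zero, dist_zero_right] at this
      have h3 : ‖L t‖ ≤ ‖g t‖ + ‖x₀‖ := by
        have : L t = g t - x₀ := by rw [hg]; abel
        rw [this]
        exact norm_sub_le _ _
      have h4 : 1 + ‖t‖ ≤ C * (1 + ‖g t‖) := by
        have h5 : ‖t‖ ≤ K * (‖g t‖ + ‖x₀‖) := h2.trans (mul_le_mul_of_nonneg_left h3 K.2)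
        have h6 : 0 ≤ K * ‖x₀‖ * ‖g t‖ := by positivity
        have h7 := norm_nonneg (g t)
        have h8 : (0 : ℝ) ≤ K := K.2
        rw [hC]
        nlinarith
      rw [Function.comp_apply, Real.rpow_neg (by positivity), Real.rpow_natCast,
        Real.norm_of_nonneg (by positivity), ← div_eq_mul_inv, inv_eq_one_div,
        div_le_div_iff₀ (by positivity) (by positivity), one_mul, ← mul_pow]
      exact pow_le_pow_left₀ (by positivity) h4 _
  · intro u hu huA
    have h1 : x₀ + u ∈ (A : Set (Vd d)) := by
      rw [add_comm]
      exact AffineSubspace.vadd_mem_of_mem_direction huA hx₀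
    rw [hAeq] at h1
    obtain ⟨s, hs⟩ := h1
    have hs' : u = L s := by rw [hL]; exact add_left_cancel hs
    refine ⟨measurable_add_const u, ?_⟩
    have h2 := (measurePreserving_add_right (volume : Measure (Fin k → ℝ)) s).map_eq
    rw [hgm, Measure.map_map (measurable_add_const u) hemb.measurable]
    conv_rhs => rw [← h2]
    rw [Measure.map_map hemb.measurable (measurable_add_const s)]
    congr 1
    ext1 t
    simp only [Function.comp_apply, hg, map_add, hs']
    abel

end Instances

section Faces

variable {d : ℕ}

/-- a point of the relative interior can be pushed slightly away from any other point. -/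
theorem intrinsicInterior_extend {F : Set (Vd d)} {x y : Vd d} (hx : x ∈ intrinsicInterior ℝ F)
    (hy : y ∈ affineSpan ℝ F) : ∃ δ : ℝ, 0 < δ ∧ x + δ • (x - y) ∈ F := by
  obtain ⟨z, hz, rfl⟩ := mem_intrinsicInterior.1 hx
  have hmem : ∀ t : ℝ, (z : Vd d) + t • ((z : Vd d) - y) ∈ affineSpan ℝ F := by
    intro t
    have := AffineSubspace.smul_vsub_vadd_mem (affineSpan ℝ F) t z.2 hy z.2
    rw [vsub_eq_sub, vadd_eq_add] at this
    rwa [add_comm]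
  let g : ℝ → affineSpan ℝ F := fun t => ⟨(z : Vd d) + t • ((z : Vd d) - y), hmem t⟩
  have hg : Continuous g := by
    apply Continuous.subtype_mk
    fun_prop
  have hg0 : g 0 = z := Subtype.ext (by simp [g])
  have h1 : ∀ᶠ t in 𝓝 (0 : ℝ), g t ∈ interior ((↑) ⁻¹' F : Set (affineSpan ℝ F)) := by
    apply hg.continuousAt.eventually_mem
    rw [hg0]
    exact isOpen_interior.mem_nhds hz
  have h2 : ∀ᶠ t in 𝓝[>] (0 : ℝ), g t ∈ interior ((↑) ⁻¹' F : Set (affineSpan ℝ F)) :=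
    h1.filter_mono nhdsWithin_le_nhds
  obtain ⟨t, ht, ht0⟩ := (h2.and self_mem_nhdsWithin).exists
  have h3 : g t ∈ ((↑) ⁻¹' F : Set (affineSpan ℝ F)) := interior_subset ht
  exact ⟨t, ht0, h3⟩

/-- the face of a polyhedron where the constraints in `K` are tight. -/
def fc {ι : Type*} (φ : ι → Vd d) (c : ι → ℚ) (K : Set ι) : Set (Vd d) :=
  {y | y ∈ hpoly φ c ∧ ∀ i ∈ K, pairE (φ i) y = c i}

/-- the constraints which are tight on all of `F`. -/
def act {ι : Type*} (φ : ι → Vd d) (c : ι → ℚ) (F : Set (Vd d)) : Set ι :=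
  {i | ∀ y ∈ F, pairE (φ i) y = c i}

/-- the affine subspace where the constraints in `K` are tight. -/
def eqA {ι : Type*} (φ : ι → Vd d) (c : ι → ℚ) (K : Set ι) : AffineSubspace ℝ (Vd d) where
  carrier := {y | ∀ i ∈ K, pairE (φ i) y = c i}
  smul_vsub_vadd_mem' := by
    intro t p q r hp hq hr i hi
    rw [vsub_eq_sub, vadd_eq_add, pairE_add, pairE_smul, pairE_sub, hp i hi, hq i hi, hr i hi]
    ring

theorem mem_eqA {ι : Type*} {φ : ι → Vd d} {c : ι → ℚ} {K : Set ι} {y : Vd d} :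
    y ∈ eqA φ c K ↔ ∀ i ∈ K, pairE (φ i) y = c i := Iff.rfl

theorem act_of_interior {ι : Type*} {φ : ι → Vd d} {c : ι → ℚ} {F : Set (Vd d)}
    (hF : F ⊆ hpoly φ c) {x : Vd d} (hx : x ∈ intrinsicInterior ℝ F) {i : ι}
    (hi : pairE (φ i) x = c i) : i ∈ act φ c F := by
  intro y hy
  obtain ⟨δ, hδ, h⟩ := intrinsicInterior_extend hx (subset_affineSpan ℝ F hy)
  have h1 := hF h i
  have h2 := hF hy i
  rw [pairE_add, pairE_smul, pairE_sub, hi] at h1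
  have h3 : δ * (c i - pairE (φ i) y) ≤ 0 := by linarith
  have h4 : (c i : ℝ) - pairE (φ i) y ≤ 0 := by
    by_contra hc
    push Not at hc
    have := mul_pos hδ hc
    linarith
  linarith

/-- small steps in a direction allowed by the tight constraints stay inside. -/
theorem small_step {ι : Type*} [Finite ι] {φ : ι → Vd d} {c : ι → ℚ} {x u : Vd d}
    (hx : x ∈ hpoly φ c) (h : ∀ i, pairE (φ i) x = c i → pairE (φ i) u ≤ 0) :
    ∃ ε : ℝ, 0 < ε ∧ ∀ t : ℝ, 0 < t → t ≤ ε → x + t • u ∈ hpoly φ c := by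
  have h1 : x + u ∈ tanC (hpoly φ c) x := by
    rw [tanC_hpoly _ _ hx]
    intro i hi
    rw [pairE_add, hi]
    have := h i hi
    linarith
  obtain ⟨_, ε, hε, h2⟩ := h1
  refine ⟨ε, hε, fun t ht ht' => ?_⟩
  have := h2 t ht ht'
  rwa [add_sub_cancel_left] at this

theorem isFaceOf_subset {P F : Set (Vd d)} (hF : IsFaceOf P F) : F ⊆ P := by
  obtain ⟨_, ψ, rfl⟩ := hF
  exact fun x hx => hx.1

theorem isFaceOf_convex {P F : Set (Vd d)} (hP : Convex ℝ P) (hF : IsFaceOf P F) :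
    Convex ℝ F := by
  obtain ⟨_, ψ, rfl⟩ := hF
  intro x hx y hy a b ha hb hab
  refine ⟨hP hx.1 hy.1 ha hb hab, fun z hz => ?_⟩
  rw [pairE_add, pairE_smul, pairE_smul]
  have h1 := mul_le_mul_of_nonneg_left (hx.2 z hz) ha
  have h2 := mul_le_mul_of_nonneg_left (hy.2 z hz) hb
  calc pairE ψ z = a * pairE ψ z + b * pairE ψ z := by rw [← add_mul, hab, one_mul]
    _ ≤ _ := add_le_add h1 h2

theorem face_interior {ι : Type*} {φ : ι → Vd d} {c : ι → ℚ} {F : Set (Vd d)}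
    (hF : IsFaceOf (hpoly φ c) F) : (intrinsicInterior ℝ F).Nonempty :=
  hF.1.intrinsicInterior (isFaceOf_convex (hpoly_convex φ c) hF)

theorem face_eq {ι : Type*} [Finite ι] {φ : ι → Vd d} {c : ι → ℚ} {F : Set (Vd d)}
    (hF : IsFaceOf (hpoly φ c) F) : F = fc φ c (act φ c F) := by
  obtain ⟨x, hx⟩ := face_interior hF
  have hsub := isFaceOf_subset hF
  have hxF := intrinsicInterior_subset hx
  apply Set.Subset.antisymm
  · exact fun y hy => ⟨hsub hy, fun i hi => hi y hy⟩
  · rintro y ⟨hyP, hy⟩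
    have h1 : ∀ i, pairE (φ i) x = c i → pairE (φ i) (x - y) ≤ 0 := by
      intro i hi
      rw [pairE_sub, hi, hy i (act_of_interior hsub hx hi), sub_self]
    obtain ⟨ε, hε, h2⟩ := small_step (hsub hxF) h1
    have h3 := h2 ε hε le_rfl
    obtain ⟨_, ψ, hψ⟩ := hF
    rw [hψ] at hxF ⊢
    have h4 := hxF.2 _ h3
    rw [pairE_add, pairE_smul, pairE_sub] at h4
    have h5 : pairE ψ x ≤ pairE ψ y := by
      by_contra hc
      push Not at hc
      have := mul_pos hε (sub_pos.2 hc)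
      linarith
    exact ⟨hyP, fun z hz => (hxF.2 z hz).trans h5⟩

theorem face_of {ι : Type*} [Finite ι] {φ : ι → Vd d} {c : ι → ℚ} {K : Set ι}
    (hne : (fc φ c K).Nonempty) : IsFaceOf (hpoly φ c) (fc φ c K) := by
  classical
  have := Fintype.ofFinite ι
  refine ⟨hne, ∑ i ∈ K.toFinset, φ i, ?_⟩
  have hs : ∀ y, pairE (∑ i ∈ K.toFinset, φ i) y = ∑ i ∈ K.toFinset, pairE (φ i) y := by
    intro y
    rw [pairE_comm, pairE_sum]
    exact Finset.sum_congr rfl fun i _ => pairE_comm _ _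
  obtain ⟨x, hxP, hx⟩ := hne
  have hle : ∀ y ∈ hpoly φ c, ∑ i ∈ K.toFinset, pairE (φ i) y ≤ ∑ i ∈ K.toFinset, (c i : ℝ) :=
    fun y hy => Finset.sum_le_sum fun i _ => hy i
  ext z
  constructor
  · rintro ⟨hzP, hz⟩
    refine ⟨hzP, fun y hy => ?_⟩
    rw [hs, hs]
    refine (hle y hy).trans (le_of_eq ?_)
    exact Finset.sum_congr rfl fun i hi => (hz i (Set.mem_toFinset.1 hi)).symm
  · rintro ⟨hzP, hz⟩
    refine ⟨hzP, ?_⟩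
    have h1 := hz x hxP
    rw [hs, hs, Finset.sum_congr rfl fun i hi => hx i (Set.mem_toFinset.1 hi)] at h1
    have h2 := (Finset.sum_eq_sum_iff_of_le (fun i _ => hzP i)).1 (le_antisymm (hle z hzP) h1)
    exact fun i hi => h2 i (Set.mem_toFinset.2 hi)

theorem affineSpan_face {ι : Type*} [Finite ι] {φ : ι → Vd d} {c : ι → ℚ} {F : Set (Vd d)}
    (hF : IsFaceOf (hpoly φ c) F) : affineSpan ℝ F = eqA φ c (act φ c F) := by
  obtain ⟨x, hx⟩ := face_interior hF
  have hsub := isFaceOf_subset hF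
  have hxF := intrinsicInterior_subset hx
  apply le_antisymm
  · rw [affineSpan_le]
    exact fun y hy i hi => hi y hy
  · intro y hy
    have h1 : ∀ i, pairE (φ i) x = c i → pairE (φ i) (y - x) ≤ 0 := by
      intro i hi
      rw [pairE_sub, hi, hy i (act_of_interior hsub hx hi), sub_self]
    obtain ⟨ε, hε, h2⟩ := small_step (hsub hxF) h1
    have h3 : x + ε • (y - x) ∈ F := by
      rw [face_eq hF]
      refine ⟨h2 ε hε le_rfl, fun i hi => ?_⟩
      rw [pairE_add, pairE_smul, pairE_sub, hy i hi, hi x hxF]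
      ring
    have h4 := AffineSubspace.smul_vsub_vadd_mem (affineSpan ℝ F) ε⁻¹
      (subset_affineSpan ℝ F h3) (subset_affineSpan ℝ F hxF) (subset_affineSpan ℝ F hxF)
    rw [vsub_eq_sub, vadd_eq_add, add_sub_cancel_left, smul_smul, inv_mul_cancel₀ hε.ne',
      one_smul, sub_add_cancel] at h4
    exact h4

theorem suppCone_face {ι : Type*} [Finite ι] {φ : ι → Vd d} {c : ι → ℚ} {F : Set (Vd d)}
    (hF : IsFaceOf (hpoly φ c) F) :
    suppCone (hpoly φ c) F = {y | ∀ i ∈ act φ c F, pairE (φ i) y ≤ c i} := by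
  have hsub := isFaceOf_subset hF
  ext y
  constructor
  · rintro ⟨a, ha, u, ⟨x, hx, ε, hε, h⟩, rfl⟩ i hi
    rw [affineSpan_face hF] at ha
    have h1 := h ε hε le_rfl i
    rw [pairE_add, pairE_smul, hi x (intrinsicInterior_subset hx)] at h1
    rw [pairE_add, ha i hi]
    have h2 : pairE (φ i) u ≤ 0 := by
      by_contra hc
      push Not at hc
      have := mul_pos hε hc
      linarith
    linarith
  · intro hy
    obtain ⟨x, hx⟩ := face_interior hF
    have hxF := intrinsicInterior_subset hx
    refine ⟨x, subset_affineSpan ℝ F hxF, y - x, ⟨x, hx, ?_⟩, by abel⟩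
    apply small_step (hsub hxF)
    intro i hi
    rw [pairE_sub, hi]
    have := hy i (act_of_interior hsub hx hi)
    linarith

theorem faces_finite {ι : Type*} [Finite ι] (φ : ι → Vd d) (c : ι → ℚ) :
    {F | IsFaceOf (hpoly φ c) F}.Finite := by
  refine Set.Finite.of_finite_image (f := act φ c) (Set.toFinite _) ?_
  intro F hF F' hF' h
  rw [face_eq hF, face_eq hF', h]

theorem tanC_fc {ι : Type*} {φ : ι → Vd d} {c : ι → ℚ} {K : Set ι} {w : Vd d}
    (hw : w ∈ fc φ c K) :
    tanC (fc φ c K) w = {z | z ∈ tanC (hpoly φ c) w ∧ ∀ i ∈ K, pairE (φ i) z = c i} := by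
  ext z
  constructor
  · intro hz
    refine ⟨tanC_mono (fun y hy => hy.1) w hz, ?_⟩
    have : tanC (fc φ c K) w ⊆ eqA φ c K := tanC_subset_affine (fun y hy => hy.2) w
    exact this hz
  · rintro ⟨⟨_, ε, hε, h⟩, hz⟩
    refine ⟨hw, ε, hε, fun t ht ht' => ⟨h t ht ht', fun i hi => ?_⟩⟩
    rw [pairE_add, pairE_smul, pairE_sub, hw.2 i hi, hz i hi]
    ring

theorem tanC_hpoly' {ι : Type*} [Finite ι] (φ : ι → Vd d) (c : ι → ℚ) {w : Vd d}
    (hw : w ∈ hpoly φ c) :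
    tanC (hpoly φ c) w = hpoly (fun i : {i // pairE (φ i) w = c i} => φ i)
      (fun i : {i // pairE (φ i) w = c i} => c i) := by
  rw [tanC_hpoly _ _ hw]
  ext x
  simp [hpoly]

theorem tanC_fc' {ι : Type*} [Finite ι] {φ : ι → Vd d} {c : ι → ℚ} {K : Set ι} {w : Vd d}
    (hw : w ∈ fc φ c K) :
    tanC (fc φ c K) w = fc (fun i : {i // pairE (φ i) w = c i} => φ i)
      (fun i : {i // pairE (φ i) w = c i} => c i) (Subtype.val ⁻¹' K) := by
  rw [tanC_fc hw, tanC_hpoly' φ c hw.1]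
  ext z
  refine and_congr_right fun _ => ⟨fun h i hi => h i.1 hi, fun h i hi => h ⟨i, hw.2 i hi⟩ hi⟩

/-- the tangent cones of the faces through `w` are the faces of the tangent cone. -/
theorem face_bij {ι : Type*} [Finite ι] (φ : ι → Vd d) (c : ι → ℚ) {w : Vd d}
    (hw : w ∈ hpoly φ c) :
    Set.BijOn (fun F => tanC F w) {F | IsFaceOf (hpoly φ c) F ∧ w ∈ F}
      {G | IsFaceOf (tanC (hpoly φ c) w) G} ∧
    ∀ F, IsFaceOf (hpoly φ c) F → w ∈ F → tanC F w ∩ hpoly φ c = F := by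
  have hinv : ∀ F, IsFaceOf (hpoly φ c) F → w ∈ F → tanC F w ∩ hpoly φ c = F := by
    intro F hF hwF
    have hF' := face_eq hF
    set K := act φ c F
    rw [hF'] at hwF ⊢
    rw [tanC_fc hwF]
    ext z
    constructor
    · rintro ⟨⟨h1, h2⟩, h3⟩
      exact ⟨h3, h2⟩
    · rintro ⟨h1, h2⟩
      exact ⟨⟨subset_tanC (hpoly_convex φ c) hw h1, h2⟩, h1⟩
  refine ⟨⟨?_, ?_, ?_⟩, hinv⟩
  · rintro F ⟨hF, hwF⟩
    have hF' := face_eq hF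
    set K := act φ c F
    rw [hF'] at hwF ⊢
    have h1 : w ∈ tanC (fc φ c K) w := self_mem_tanC hwF
    show IsFaceOf (tanC (hpoly φ c) w) (tanC (fc φ c K) w)
    rw [tanC_fc' hwF] at h1 ⊢
    rw [tanC_hpoly' φ c hw]
    exact face_of ⟨w, h1⟩
  · rintro F ⟨hF, hwF⟩ F' ⟨hF', hwF'⟩ h
    rw [← hinv F hF hwF, ← hinv F' hF' hwF']
    exact congrArg (· ∩ hpoly φ c) h
  · intro G hG
    have hG1 : IsFaceOf (tanC (hpoly φ c) w) G := hG
    rw [tanC_hpoly' φ c hw] at hG1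
    have hG2 := face_eq hG1
    set K' := act (fun i : {i // pairE (φ i) w = c i} => φ i)
      (fun i : {i // pairE (φ i) w = c i} => c i) G
    have hwF : w ∈ fc φ c (Subtype.val '' K') := by
      refine ⟨hw, ?_⟩
      rintro _ ⟨i, _, rfl⟩
      exact i.2
    refine ⟨fc φ c (Subtype.val '' K'), ⟨face_of ⟨w, hwF⟩, hwF⟩, ?_⟩
    show tanC (fc φ c (Subtype.val '' K')) w = G
    rw [tanC_fc' hwF, Set.preimage_image_eq _ Subtype.val_injective]
    exact hG2.symm

theorem affineSpan_tanC {F : Set (Vd d)} (hF : Convex ℝ F) {w : Vd d} (hw : w ∈ F) :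
    affineSpan ℝ (tanC F w) = affineSpan ℝ F := by
  apply le_antisymm
  · rw [affineSpan_le]
    exact tanC_subset_affine (subset_affineSpan ℝ F) w
  · exact affineSpan_mono ℝ (subset_tanC hF hw)

theorem suppCone_tanC {ι : Type*} [Finite ι] {φ : ι → Vd d} {c : ι → ℚ} {F : Set (Vd d)}
    (hF : IsFaceOf (hpoly φ c) F) {w : Vd d} (hw : w ∈ F) :
    suppCone (tanC (hpoly φ c) w) (tanC F w) = suppCone (hpoly φ c) F := by
  have hwP := isFaceOf_subset hF hw
  have hconv := isFaceOf_convex (hpoly_convex φ c) hF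
  have h1 : IsFaceOf (tanC (hpoly φ c) w) (tanC F w) := (face_bij φ c hwP).1.mapsTo ⟨hF, hw⟩
  rw [tanC_hpoly' φ c hwP] at h1 ⊢
  rw [suppCone_face h1, suppCone_face hF]
  have h2 : ∀ y ∈ tanC F w, ∀ i ∈ act φ c F, pairE (φ i) y = c i := by
    have : tanC F w ⊆ eqA φ c (act φ c F) :=
      tanC_subset_affine (fun y hy i hi => hi y hy) w
    exact this
  ext y
  constructor
  · intro hy i hi
    exact hy ⟨i, hi w hw⟩ fun z hz => h2 z hz i hi
  · intro hy i hi
    exact hy i fun z hz => hi z (subset_tanC hconv hw hz)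

theorem containsLine_tanC_face {ι : Type*} [Finite ι] {φ : ι → Vd d} {c : ι → ℚ}
    {F : Set (Vd d)} (hF : IsFaceOf (hpoly φ c) F) {w : Vd d} (hw : w ∈ F) :
    ContainsLine (tanC (hpoly φ c) w) ↔ ContainsLine (tanC F w) := by
  have hwP := isFaceOf_subset hF hw
  constructor
  · rintro ⟨x, u, hu, h⟩
    rw [tanC_hpoly' φ c hwP] at h
    have h0 := hpoly_line_iff _ _ h
    have hF' := face_eq hF
    set K := act φ c F
    rw [hF'] at hw ⊢
    refine ⟨w, u, hu, fun t => ?_⟩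
    rw [tanC_fc' hw]
    have h1 : ∀ i : {i // pairE (φ i) w = c i}, pairE (φ i) (w + t • u) = c i := by
      intro i
      rw [pairE_add, pairE_smul, h0 i, i.2]
      ring
    exact ⟨fun i => (h1 i).le, fun i _ => h1 i⟩
  · exact fun h => h.mono (tanC_mono (isFaceOf_subset hF) w)

theorem containsLine_face {ι : Type*} [Finite ι] {φ : ι → Vd d} {c : ι → ℚ}
    {F : Set (Vd d)} (hF : IsFaceOf (hpoly φ c) F) (hl : ContainsLine (hpoly φ c)) :
    ContainsLine F := by
  obtain ⟨x, u, hu, h⟩ := hl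
  have h0 := hpoly_line_iff _ _ h
  obtain ⟨y, hy⟩ := hF.1
  have hF' := face_eq hF
  set K := act φ c F
  rw [hF'] at hy ⊢
  refine ⟨y, u, hu, fun t => ?_⟩
  have h1 : ∀ i, pairE (φ i) (y + t • u) = pairE (φ i) y := by
    intro i
    rw [pairE_add, pairE_smul, h0 i]
    ring
  exact ⟨fun i => by rw [h1]; exact hy.1 i, fun i hi => by rw [h1]; exact hy.2 i hi⟩

theorem ratPoly_eqA {Λ : AddSubgroup (Vd d)} (hΛ : IsFullLattice Λ) {ι : Type*} [Finite ι]
    {φ : ι → Vd d} (c : ι → ℚ) (h : ∀ i, IsDualIntegral Λ (φ i)) (K : Set ι) :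
    IsRatPolyhedron Λ (eqA φ c K : Set (Vd d)) := by
  have := ratPoly_of hΛ (Sum.elim (fun i : K => φ i) (fun i : K => - φ i))
    (Sum.elim (fun i : K => c i) (fun i : K => - c i))
    (by rintro (i | i); exacts [h i, (h i).neg])
  convert this using 1
  ext x
  constructor
  · rintro hx (i | i)
    · exact (hx i.1 i.2).le
    · simp only [Sum.elim_inr, pairE_neg_left]
      rw [hx i.1 i.2]
      simp
  · intro hx i hi
    have h1 := hx (Sum.inl ⟨i, hi⟩)
    have h2 := hx (Sum.inr ⟨i, hi⟩)
    simp only [Sum.elim_inl, Sum.elim_inr, pairE_neg_left] at h1 h2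
    push_cast at h2
    linarith

/-- Brion's formula for the integrals over a face, with the vertices of the polyhedron. -/
theorem brion_face {Λ : AddSubgroup (Vd d)} (hΛ : IsFullLattice Λ) {I : Set (Vd d) → Vd d → ℝ}
    (hI : IsIMap Λ I) {ι : Type*} [Finite ι] {φ : ι → Vd d} {c : ι → ℚ}
    (h : ∀ i, IsDualIntegral Λ (φ i)) (hl : ¬ ContainsLine (hpoly φ c)) {F : Set (Vd d)}
    (hF : IsFaceOf (hpoly φ c) F) (W : Finset (Vd d))
    (hW : ∀ w, w ∈ W ↔ w ∈ F ∧ ¬ ContainsLine (tanC F w)) :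
    toG (I F) = ∑ w ∈ W, toG (I (tanC F w)) := by
  have hA := ratPoly_eqA hΛ c h (act φ c F)
  have hspan := affineSpan_face hF
  have hsub := isFaceOf_subset hF
  have hconv := isFaceOf_convex (hpoly_convex φ c) hF
  have hFA : F ⊆ (eqA φ c (act φ c F) : Set (Vd d)) := fun y hy i hi => hi y hy
  have hFr : IsRatPolyhedron Λ F := by
    have h1 : F = hpoly φ c ∩ (eqA φ c (act φ c F) : Set (Vd d)) := face_eq hF
    rw [h1]
    exact ratPoly_inter hΛ (ratPoly_of hΛ φ c h) hA
  obtain ⟨x, hx⟩ := hF.1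
  obtain ⟨m, hm⟩ := exists_canonical hΛ (fun i : act φ c F => φ i) (fun i => h i)
    (fun i : act φ c F => (c i : ℝ)) (x₀ := x) (fun i => i.2 x hx)
  have hm' : IsCanonicalMeasure Λ (eqA φ c (act φ c F) : Set (Vd d)) m := by
    convert hm using 1
    ext y
    simp [mem_eqA]
  have key := (valData_I hΛ hI hA hm').brion hΛ hA hFr hFA (fun hc => hl (hc.mono hsub)) ⟨x, hx⟩ W hW
  have hT : ∀ G : Set (Vd d), G ⊆ (eqA φ c (act φ c F) : Set (Vd d)) →
      affineSpan ℝ G = eqA φ c (act φ c F) → TI I (eqA φ c (act φ c F)) G = I G := by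
    intro G h1 h2
    unfold TI
    rw [Set.inter_eq_left.2 h1, if_pos h2]
  rw [hT F hFA hspan] at key
  rw [key]
  refine Finset.sum_congr rfl fun w hw => ?_
  have hwF := ((hW w).1 hw).1
  rw [hT _ (tanC_subset_affine hFA w) (by rw [affineSpan_tanC hconv hwF, hspan])]

theorem isQuotLattice_self (Q : Vd d →ₗ[ℝ] Vd d →ₗ[ℝ] ℝ) (Λ : AddSubgroup (Vd d)) :
    IsQuotLattice Q Λ Λ := by
  refine ⟨⊥, LinearMap.id, ?_, ⟨fun x => by simp, fun x y hy => ?_⟩, ?_⟩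
  · rw [eq_bot_iff, Submodule.span_le]
    exact Set.inter_subset_left
  · rw [(Submodule.mem_bot ℝ).1 hy, map_zero]
  · ext x
    simp

end Faces

/-- for any rational polyhedron `P`,
`S(P)(ξ) = ∑_{f ∈ F(P)} μ(t(P,f))(ξ) · I(f)(ξ)`, the sum being over all faces of `P`, where
the transverse cone `t(P,f)` is realized via the `Q`-orthogonal projection `π F` along
`lin(f)` (and `μ(t(P,f))` is regarded as a function on `V^*` via `Q`-orthogonal
projection). -/
theorem statement13 (d : ℕ) (Λ : AddSubgroup (Vd d)) (hΛ : IsFullLattice Λ)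
    (Q : Vd d →ₗ[ℝ] Vd d →ₗ[ℝ] ℝ) (hQ : IsRatInner Λ Q)
    (I S μ : AddSubgroup (Vd d) → Set (Vd d) → Vd d → ℝ)
    (hI : IsIFamily Q Λ I) (hS : IsSFamily Q Λ S) (hμ : IsMuFamily Λ Q I S μ)
    (P : Set (Vd d)) (hP : IsRatPolyhedron Λ P)
    (π : Set (Vd d) → (Vd d →ₗ[ℝ] Vd d))
    (hπ : ∀ F, IsFaceOf P F → IsQCoproj Q (affineSpan ℝ F).direction (π F)) :
    MeroEqAt0 (S Λ P)
      (fun ξ => ∑ᶠ F ∈ {F | IsFaceOf P F},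
        μ (AddSubgroup.map (π F).toAddMonoidHom Λ) ((π F) '' suppCone P F) ξ * I Λ F ξ) := by
  classical
  have hq := isQuotLattice_self Q Λ
  have hIΛ := hI Λ hq
  have hSΛ := hS Λ hq
  obtain ⟨n, φ, c, hintg, hPeq⟩ := ratPoly_exists hΛ hP
  subst hPeq
  rw [meroEq_iff, ← toG_eq]
  have hfin := faces_finite φ c
  set Φ : Finset (Set (Vd d)) := hfin.toFinset with hΦ
  have hmemΦ : ∀ F, F ∈ Φ ↔ IsFaceOf (hpoly φ c) F := fun F => hfin.mem_toFinset
  have hrhs : (fun ξ => ∑ᶠ F ∈ {F | IsFaceOf (hpoly φ c) F},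
        μ (AddSubgroup.map (π F).toAddMonoidHom Λ) ((π F) '' suppCone (hpoly φ c) F) ξ * I Λ F ξ)
      = fun ξ => ∑ F ∈ Φ,
        μ (AddSubgroup.map (π F).toAddMonoidHom Λ) ((π F) '' suppCone (hpoly φ c) F) ξ
          * I Λ F ξ := by
    ext1 ξ
    exact finsum_mem_eq_finite_toFinset_sum _ hfin
  rw [hrhs]
  have hFr : ∀ F, IsFaceOf (hpoly φ c) F → IsRatPolyhedron Λ F := by
    intro F hF
    have h1 : F = hpoly φ c ∩ (eqA φ c (act φ c F) : Set (Vd d)) := face_eq hF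
    rw [h1]
    exact ratPoly_inter hΛ (ratPoly_of hΛ φ c hintg) (ratPoly_eqA hΛ c hintg _)
  by_cases hl : ContainsLine (hpoly φ c)
  · have h1 : S Λ (hpoly φ c) = fun _ => 0 := funext (hSΛ.2.1 _ hP hl)
    rw [h1]
    congr 1
    ext1 ξ
    symm
    refine Finset.sum_eq_zero fun F hF => ?_
    have hF' := (hmemΦ F).1 hF
    rw [hIΛ.2.1 F (hFr F hF') (containsLine_face hF' hl), mul_zero]
  rcases (hpoly φ c).eq_empty_or_nonempty with hem | hne
  · congr 1
    ext1 ξ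
    have hemp : IsEmpty ↥(hpoly φ c ∩ (Λ : Set (Vd d))) := by
      rw [hem, Set.empty_inter]
      infer_instance
    rw [hSΛ.2.2 _ hP ξ summable_empty, tsum_empty]
    symm
    refine Finset.sum_eq_zero fun F hF => ?_
    obtain ⟨x, hx⟩ := ((hmemΦ F).1 hF).1
    have := isFaceOf_subset ((hmemΦ F).1 hF) hx
    rw [hem] at this
    exact this.elim
  have hWfin := vertices_finite hΛ hP
  set W : Finset (Vd d) := hWfin.toFinset with hWdef
  have hW : ∀ w, w ∈ W ↔ w ∈ hpoly φ c ∧ ¬ ContainsLine (tanC (hpoly φ c) w) :=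
    fun w => hWfin.mem_toFinset
  have hAtop : IsRatPolyhedron Λ ((⊤ : AffineSubspace ℝ (Vd d)) : Set (Vd d)) := by
    rw [AffineSubspace.top_coe]
    exact ratPoly_univ hΛ
  rw [(valData_S hΛ hSΛ).brion hΛ hAtop hP (fun _ _ => trivial) hl hne W hW]
  set M : Set (Vd d) → Vd d → ℝ := fun F =>
    μ (AddSubgroup.map (π F).toAddMonoidHom Λ) ((π F) '' suppCone (hpoly φ c) F) with hM
  have hcone : ∀ w ∈ W, toG (S Λ (tanC (hpoly φ c) w)) =
      ∑ F ∈ Φ.filter (fun F => w ∈ F), toG (M F) * toG (I Λ (tanC F w)) := by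
    intro w hw
    obtain ⟨hwP, hwl⟩ := (hW w).1 hw
    obtain ⟨hbij, hinv⟩ := face_bij φ c hwP
    have h1 := hμ.1.2.2 Λ hq (tanC (hpoly φ c) w) (ratAffineCone_tanC hΛ hP hwP hwl) hwl
      (fun G => π (G ∩ hpoly φ c)) (by
        intro G hG
        obtain ⟨F, ⟨hF, hwF⟩, rfl⟩ := hbij.surjOn hG
        simp only [hinv F hF hwF]
        rw [affineSpan_tanC (isFaceOf_convex (hpoly_convex φ c) hF) hwF]
        exact hπ F hF)
    rw [meroEq_iff, ← toG_eq] at h1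
    rw [h1]
    have h2 : ∀ F G, toG (M F) * toG (I Λ G) = toG (fun ξ => M F ξ * I Λ G ξ) :=
      fun F G => (toG_mul _ _).symm
    simp only [h2]
    rw [← toG_sum]
    congr 1
    ext1 ξ
    have h3 : ((Φ.filter (fun F => w ∈ F) : Finset (Set (Vd d))) : Set (Set (Vd d))) =
        {F | IsFaceOf (hpoly φ c) F ∧ w ∈ F} := by
      ext F
      simp [hmemΦ]
    rw [← finsum_mem_coe_finset, h3]
    symm
    refine finsum_mem_eq_of_bijOn _ hbij ?_
    rintro F ⟨hF, hwF⟩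
    simp only [hinv F hF hwF, suppCone_tanC hF hwF, hM]
  rw [Finset.sum_congr rfl hcone, toG_sum]
  simp only [Finset.sum_filter]
  rw [Finset.sum_comm]
  refine Finset.sum_congr rfl fun F hF => ?_
  have hF' := (hmemΦ F).1 hF
  have hWF : ∀ w, w ∈ W.filter (fun w => w ∈ F) ↔ w ∈ F ∧ ¬ ContainsLine (tanC F w) := by
    intro w
    rw [Finset.mem_filter, hW]
    constructor
    · rintro ⟨⟨_, h2⟩, h3⟩
      exact ⟨h3, fun hc => h2 ((containsLine_tanC_face hF' h3).2 hc)⟩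
    · rintro ⟨h1, h2⟩
      exact ⟨⟨isFaceOf_subset hF' h1, fun hc => h2 ((containsLine_tanC_face hF' h1).1 hc)⟩, h1⟩
  rw [← Finset.sum_filter, ← Finset.mul_sum, ← brion_face hΛ hIΛ hintg hl hF' _ hWF]
  exact (toG_mul _ _).symm
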